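/- For every x ∈ Δ and every γ > 0, lim_{t→∞} t^{2−γ} ‖P^t(x,·) − π‖_TV = 0. -/

import Mathlib

open MeasureTheory Set Filter

noncomputable section

/-- The open set `U ⊂ ℝ^m` with which the open simplex `Δ` is identified
(via `y = Ē - ∑ i, x i`). -/
def simU (m : ℕ) (E : ℝ) : Set (Fin m → ℝ) := {x | (∀ i, 0 < x i) ∧ ∑ i, x i < E}

/-- The state space `Δ`. -/
abbrev Delta (m : ℕ) (E : ℝ) : Type := ↥(simU m E)

/-- The tank energy `y = Ē - ∑ i, x i`. -/
def tank (m : ℕ) (E : ℝ) (x : Delta m E) : ℝ := E - ∑ i, x.1 i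

/-- The energy exchange map on the ambient space: particle `i` gets energy
`y + (1-u²) x^i`, and the new tank energy is `u² x^i`. -/
def T0 (m : ℕ) (E : ℝ) (i : Fin m) (u : ℝ) (x : Fin m → ℝ) : Fin m → ℝ :=
  Function.update x i ((E - ∑ j, x j) + (1 - u ^ 2) * x i)

lemma T0_mem {m : ℕ} {E : ℝ} {i : Fin m} {u : ℝ} {x : Fin m → ℝ}
    (hx : x ∈ simU m E) (hu : u ∈ Ioo (0:ℝ) 1) : T0 m E i u x ∈ simU m E := by
  obtain ⟨hpos, hsum⟩ := hx
  obtain ⟨hu0, hu1⟩ := hu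
  have hy : 0 < E - ∑ j, x j := sub_pos.mpr hsum
  have hu2 : 0 < 1 - u ^ 2 := by nlinarith
  have hxi := hpos i
  constructor
  · intro j
    rcases eq_or_ne j i with rfl | hj
    · simp only [T0, Function.update_self]
      nlinarith
    · simpa [T0, Function.update_of_ne hj] using hpos j
  · have h1 : ∑ j, T0 m E i u x j
        = ((E - ∑ j, x j) + (1 - u ^ 2) * x i) + ∑ j ∈ Finset.univ \ {i}, x j := by
      simp only [T0]
      rw [Finset.sum_update_of_mem (Finset.mem_univ i)]
    have h2 : ∑ j ∈ Finset.univ \ {i}, x j = (∑ j, x j) - x i := by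
      rw [← Finset.erase_eq]
      exact Finset.sum_erase_eq_sub (Finset.mem_univ i)
    rw [h1, h2]
    nlinarith [mul_pos (mul_pos hu0 hu0) hxi]

/-- The energy exchange map `T_{i,u} : Δ → Δ` (defined to be the identity for
`u ∉ (0,1)`, which is a probability-zero event). -/
def Texch (m : ℕ) (E : ℝ) (i : Fin m) (u : ℝ) (x : Delta m E) : Delta m E :=
  if hu : u ∈ Ioo (0:ℝ) 1 then ⟨T0 m E i u x.1, T0_mem x.2 hu⟩ else x

/-- The uniform distribution on `(0,1)`. -/
def unif01 : Measure ℝ := volume.restrict (Ioo (0:ℝ) 1)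

/-- The uniformization constant `Λ = √(m Ē)`, an upper bound for the total jump rate. -/
def Lam (m : ℕ) (E : ℝ) : ℝ := Real.sqrt (m * E)

/-- The total jump rate `∑ i, √(x^i)`. -/
def jumpRate (m : ℕ) (E : ℝ) (x : Delta m E) : ℝ := ∑ i, Real.sqrt (x.1 i)

/-- One step of the uniformized embedded chain: with probability `1 - r(x)/Λ` stay put,
and with probability `√(x^i)/Λ` particle `i` exchanges energy with the tank, with
`u` drawn uniformly from `(0,1)`. -/
def ustep (m : ℕ) (E : ℝ) (x : Delta m E) : Measure (Delta m E) :=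
  ENNReal.ofReal (1 - jumpRate m E x / Lam m E) • Measure.dirac x
  + (ENNReal.ofReal (Lam m E))⁻¹ •
      Measure.sum (fun i : Fin m =>
        ENNReal.ofReal (Real.sqrt (x.1 i)) • Measure.map (fun u => Texch m E i u x) unif01)

/-- `n`-fold iterate of the uniformized chain. -/
def ustepIter (m : ℕ) (E : ℝ) : ℕ → Delta m E → Measure (Delta m E)
  | 0 => fun x => Measure.dirac x
  | (n+1) => fun x => (ustep m E x).bind (ustepIter m E n)

/-- The transition probabilities `P^t(x, ·)` of the energy-exchange jump process,
constructed by uniformization: `P^t = ∑ₙ e^{-Λt} (Λt)ⁿ/n! Kⁿ`. -/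
def Pt (m : ℕ) (E : ℝ) (t : ℝ) (x : Delta m E) : Measure (Delta m E) :=
  Measure.sum (fun n : ℕ =>
    ENNReal.ofReal (Real.exp (-(Lam m E) * t) * ((Lam m E) * t) ^ n / n.factorial) •
      ustepIter m E n x)

/-- Lebesgue measure on `Δ ≅ U`. -/
def lebU (m : ℕ) (E : ℝ) : Measure (Delta m E) := Measure.comap Subtype.val volume

/-- The (unnormalized) measure with density `y^{-1/2}` w.r.t. Lebesgue measure on `U`. -/
def piPre (m : ℕ) (E : ℝ) : Measure (Delta m E) :=
  (lebU m E).withDensity (fun x => ENNReal.ofReal ((tank m E x) ^ (-(1/2) : ℝ)))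

/-- The invariant probability measure `π`, with density `Z⁻¹ y^{-1/2}`. -/
def piMeasure (m : ℕ) (E : ℝ) : Measure (Delta m E) :=
  (piPre m E Set.univ)⁻¹ • piPre m E

/-- Total variation distance between two (finite) measures:
`sup_A |μ(A) - ν(A)|`. -/
def tvDist {X : Type*} [MeasurableSpace X] (μ ν : Measure X) : ℝ :=
  ⨆ A : {A : Set X // MeasurableSet A}, |(μ A.1).toReal - (ν A.1).toReal|

end

lemma onestep {X : Type*} [MeasurableSpace X] (μ1 μ2 ν : Measure X) [IsProbabilityMeasure μ1]
    [IsProbabilityMeasure μ2] (V : X → ℝ) (hV0 : ∀ x, 0 ≤ V x) (hi1 : Integrable V μ1)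
    (hi2 : Integrable V μ2) (g : X → ℝ) (hg1 : Integrable g μ1) (hg2 : Integrable g μ2)
    (α β : ℝ) (hβ : 0 ≤ β) (h : ∀ x y, |g x - g y| ≤ α + β * (V x + V y))
    (hν1 : ν ≤ μ1) (hν2 : ν ≤ μ2) :
    |∫ x, g x ∂μ1 - ∫ x, g x ∂μ2| ≤ (1 - ν.real univ) * α
      + β * (∫ x, V x ∂μ1 + ∫ x, V x ∂μ2) := by
  have : Nonempty X := nonempty_of_isProbabilityMeasure μ1
  obtain ⟨m, hm1, hm2⟩ : ∃ m : ℝ, (∀ x, g x - β * V x - α / 2 ≤ m) ∧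
      (∀ x, m ≤ g x + β * V x + α / 2) := by
    have hb : ∀ x y, g x - β * V x - α / 2 ≤ g y + β * V y + α / 2 := by
      intro x y
      have := (abs_le.1 (h x y)).2
      linarith
    refine ⟨⨆ x, (g x - β * V x - α / 2), fun x => ?_, fun y => ciSup_le fun x => hb x y⟩
    refine le_ciSup (f := fun x => g x - β * V x - α / 2) ⟨g x + β * V x + α / 2, ?_⟩ x
    rintro _ ⟨z, rfl⟩; exact hb z x
  have : IsFiniteMeasure ν := isFiniteMeasure_of_le μ1 hν1
  have hgν : Integrable g ν := hg1.mono_measure hν1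
  have hVν : Integrable V ν := hi1.mono_measure hν1
  have e1 : ∀ (μ : Measure X) [IsFiniteMeasure μ], Integrable V μ → Integrable g μ →
      Integrable (fun x => α / 2 + β * V x + m - g x) μ ∧ 
      ∫ x, (α / 2 + β * V x + m - g x) ∂μ
        = μ.real univ * (α/2) + β * ∫ x, V x ∂μ + μ.real univ * m - ∫ x, g x ∂μ := by
    intro μ _ h1 h2
    have i1 : Integrable (fun x => α / 2 + β * V x) μ := (integrable_const _).add (h1.const_mul β)
    have i2 : Integrable (fun x => α / 2 + β * V x + m) μ := i1.add (integrable_const _)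
    refine ⟨i2.sub h2, ?_⟩
    rw [integral_sub i2 h2, integral_add i1 (integrable_const _),
      integral_add (integrable_const _) (h1.const_mul β), integral_const_mul]
    simp
  have e2 : ∀ (μ : Measure X) [IsFiniteMeasure μ], Integrable V μ → Integrable g μ →
      Integrable (fun x => α / 2 + β * V x - m + g x) μ ∧ 
      ∫ x, (α / 2 + β * V x - m + g x) ∂μ
        = μ.real univ * (α/2) + β * ∫ x, V x ∂μ - μ.real univ * m + ∫ x, g x ∂μ := by
    intro μ _ h1 h2
    have i1 : Integrable (fun x => α / 2 + β * V x) μ := (integrable_const _).add (h1.const_mul β)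
    have i2 : Integrable (fun x => α / 2 + β * V x - m) μ := i1.sub (integrable_const _)
    refine ⟨i2.add h2, ?_⟩
    rw [integral_add i2 h2, integral_sub i1 (integrable_const _),
      integral_add (integrable_const _) (h1.const_mul β), integral_const_mul]
    simp
  have p1 : ∀ x, 0 ≤ α / 2 + β * V x + m - g x := fun x => by linarith [hm1 x]
  have p2 : ∀ x, 0 ≤ α / 2 + β * V x - m + g x := fun x => by linarith [hm2 x]
  have k1 : ∀ (μ : Measure X) [IsProbabilityMeasure μ], ν ≤ μ → Integrable V μ → Integrable g μ →
      ν.real univ * (α/2) + β * ∫ x, V x ∂ν + ν.real univ * m - ∫ x, g x ∂ν ≤ 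
       (α/2) + β * ∫ x, V x ∂μ + m - ∫ x, g x ∂μ := by
    intro μ _ hle h1 h2
    have := integral_mono_measure hle (ae_of_all _ p1) (e1 μ h1 h2).1
    rw [(e1 μ h1 h2).2, (e1 ν hVν hgν).2] at this
    simpa using this
  have k2 : ∀ (μ : Measure X) [IsProbabilityMeasure μ], ν ≤ μ → Integrable V μ → Integrable g μ →
      ν.real univ * (α/2) + β * ∫ x, V x ∂ν - ν.real univ * m + ∫ x, g x ∂ν ≤ 
       (α/2) + β * ∫ x, V x ∂μ - m + ∫ x, g x ∂μ := by
    intro μ _ hle h1 h2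
    have := integral_mono_measure hle (ae_of_all _ p2) (e2 μ h1 h2).1
    rw [(e2 μ h1 h2).2, (e2 ν hVν hgν).2] at this
    simpa using this
  have q : 0 ≤ β * ∫ x, V x ∂ν := mul_nonneg hβ (integral_nonneg hV0)
  have a1 := k1 μ1 hν1 hi1 hg1
  have a2 := k2 μ1 hν1 hi1 hg1
  have b1 := k1 μ2 hν2 hi2 hg2
  have b2 := k2 μ2 hν2 hi2 hg2
  rw [abs_le]
  constructor <;> nlinarith

lemma conv_ineq (p θ a b : ℝ) (hp : 1 ≤ p) (h0 : 0 < θ) (h1 : θ < 1) (ha : 0 ≤ a) (hb : 0 ≤ b) :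
    (a + b) ^ p ≤ θ ^ (1 - p) * a ^ p + (1 - θ) ^ (1 - p) * b ^ p := by
  have h2 : 0 < 1 - θ := by linarith
  have := (convexOn_rpow hp).2 (x := a / θ) (y := b / (1 - θ)) (by simp; positivity)
    (by simp; positivity) h0.le h2.le (by ring)
  simp only [smul_eq_mul] at this
  rw [mul_div_cancel₀ _ h0.ne', mul_div_cancel₀ _ h2.ne', Real.div_rpow ha h0.le,
    Real.div_rpow hb h2.le] at this
  rw [Real.rpow_sub h0, Real.rpow_sub h2, Real.rpow_one, Real.rpow_one]
  refine this.trans (le_of_eq ?_)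
  ring

lemma conv_eq (p a b : ℝ) (ha : 0 < a) (hb : 0 < b) :
    (a / (a + b)) ^ (1 - p) * a ^ p + (1 - a / (a + b)) ^ (1 - p) * b ^ p = (a + b) ^ p := by
  have hab : 0 < a + b := by linarith
  have : 1 - a / (a + b) = b / (a + b) := by field_simp; ring
  have key : ∀ c, 0 < c → (c / (a + b)) ^ (1 - p) * c ^ p = c * (a + b) ^ (p - 1) := by
    intro c hc
    rw [Real.div_rpow hc.le hab.le, div_mul_eq_mul_div, ← Real.rpow_add hc]
    rw [show p - 1 = -(1 - p) by ring, Real.rpow_neg hab.le]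
    simp [div_eq_mul_inv]
  rw [this, key a ha, key b hb, ← add_mul, Real.rpow_sub hab, Real.rpow_one]
  field_simp

lemma large_sigma (p η κ B : ℝ) (hp : 1 < p) (h0 : 0 < η) (h1 : η ≤ 1) (hκ : 0 < κ) :
    ∃ θ : ℝ, 0 < θ ∧ θ < 1 ∧ ∃ σ0 : ℝ, 0 < σ0 ∧ ∀ σ, σ0 ≤ σ →
      (1 - η) * (θ ^ (1 - p) * (σ + κ) ^ p) + (1 - θ) ^ (1 - p) * B ≤ σ ^ p := by
  have t1 : Tendsto (fun θ : ℝ => (1 - η) * θ ^ (1 - p)) (nhdsWithin 1 (Iio 1)) (nhds (1 - η)) := by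
    have : ContinuousAt (fun θ : ℝ => (1 - η) * θ ^ (1 - p)) 1 :=
      (Real.continuousAt_rpow_const 1 (1 - p) (Or.inl one_ne_zero)).const_mul _
    have := this.tendsto.mono_left (nhdsWithin_le_nhds (s := Iio 1))
    simpa using this
  have e1 := t1.eventually (gt_mem_nhds (show 1 - η < 1 by linarith))
  have e2 : ∀ᶠ θ : ℝ in nhdsWithin 1 (Iio 1), 0 < θ :=
    nhdsWithin_le_nhds (lt_mem_nhds (show (0:ℝ) < 1 by norm_num))
  have e3 : ∀ᶠ θ : ℝ in nhdsWithin 1 (Iio 1), θ < 1 := eventually_mem_nhdsWithin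
  obtain ⟨θ, ⟨h3, h4⟩, h5⟩ := ((e1.and e2).and e3).exists
  refine ⟨θ, h4, h5, ?_⟩
  have t2 : Tendsto (fun σ : ℝ => (1 - η) * θ ^ (1 - p) * (1 + κ * σ⁻¹) ^ p
      + ((1 - θ) ^ (1 - p) * B) * σ ^ (-p)) atTop
      (nhds ((1 - η) * θ ^ (1 - p) * (1 + κ * 0) ^ p + ((1 - θ) ^ (1 - p) * B) * 0)) := by
    refine Tendsto.add (Tendsto.const_mul _ (Tendsto.rpow_const ?_ (Or.inr (by linarith)))) 
      ((tendsto_rpow_neg_atTop (by linarith)).const_mul _)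
    exact tendsto_const_nhds.add (tendsto_inv_atTop_zero.const_mul κ)
  have := t2.eventually (gt_mem_nhds (show _ < (1:ℝ) by simpa using h3))
  obtain ⟨s, hs⟩ := eventually_atTop.1 this
  refine ⟨max s 1, by positivity, fun σ hσ => ?_⟩
  have hσ1 : 0 < σ := lt_of_lt_of_le one_pos ((le_max_right _ _).trans hσ)
  have := hs σ ((le_max_left _ _).trans hσ)
  have e : (σ + κ) = σ * (1 + κ * σ⁻¹) := by field_simp
  have e' : σ ^ p * σ ^ (-p) = 1 := by rw [← Real.rpow_add hσ1]; simp
  rw [e, Real.mul_rpow hσ1.le (by positivity)]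
  have := mul_le_mul_of_nonneg_left this.le (Real.rpow_nonneg hσ1.le p)
  calc _ = σ ^ p * ((1 - η) * θ ^ (1 - p) * (1 + κ * σ⁻¹) ^ p) 
        + (σ ^ p * σ ^ (-p)) * ((1 - θ) ^ (1 - p) * B) := by rw [e']; ring
    _ ≤ _ := by linarith

theorem abs_rate {X : Type*} [MeasurableSpace X] (Q : X → Measure X)
    [∀ x, IsProbabilityMeasure (Q x)] (V : X → ℝ) (hV : ∀ x, 0 < V x) (p c B : ℝ) (hp : 1 < p)
    (hc : 0 < c) (C : Set X) (ν : Measure X) (hint : ∀ x, Integrable V (Q x))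
    (hD : ∀ x y, ¬ (x ∈ C ∧ y ∈ C) →
      ∫ z, V z ∂(Q x) + ∫ z, V z ∂(Q y) + c * (V x + V y) ^ (1 - 1 / p) ≤ V x + V y)
    (hB : ∀ x ∈ C, ∫ z, V z ∂(Q x) ≤ B) (hM : ∀ x ∈ C, ν ≤ Q x) (hν : ν univ ≠ 0)
    (hC : C.Nonempty) :
    ∃ κ σ0 : ℝ, 0 < κ ∧ 0 < σ0 ∧ ∀ h : ℕ → X → ℝ, (∀ q x, Integrable (h q) (Q x)) →
      (∀ q x, h (q + 1) x = ∫ z, h q z ∂(Q x)) → (∀ x, 0 ≤ h 0 x ∧ h 0 x ≤ 1) →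
      ∀ (q : ℕ) x y, |h q x - h q y| ≤
        (σ0 + q * κ) ^ (-p) * (σ0 + (V x + V y) ^ (1 / p)) ^ p := by
  obtain ⟨x0, hx0⟩ := hC
  have fν : IsFiniteMeasure ν := isFiniteMeasure_of_le _ (hM x0 hx0)
  have hη0 : 0 < ν.real univ := by
    rw [measureReal_def]; exact ENNReal.toReal_pos hν (measure_ne_top _ _)
  have hη1 : ν.real univ ≤ 1 := by
    have : ν univ ≤ 1 := by simpa using hM x0 hx0 univ
    rw [measureReal_def]
    exact ENNReal.toReal_le_of_le_ofReal zero_le_one (by simpa using this)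
  have hp0 : 0 < p := by linarith
  obtain ⟨θ0, hθ0, hθ1, σ0, hσ0, hσ⟩ := large_sigma p (ν.real univ) (c / p) (2 * B) hp hη0 hη1
    (by positivity)
  refine ⟨c / p, σ0, by positivity, hσ0, fun h hh hrec h01 => ?_⟩
  set κ := c / p with hκ
  have hκ0 : 0 < κ := by positivity
  have main : ∀ (q : ℕ) (σ : ℝ), σ0 ≤ σ → ∀ x y, |h q x - h q y| ≤
        (σ + q * κ) ^ (-p) * (σ + (V x + V y) ^ (1 / p)) ^ p := by
    intro q
    induction q with
    | zero =>
      intro σ hs x y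
      have hs0 : 0 < σ := by linarith
      have hW : 0 < V x + V y := add_pos (hV x) (hV y)
      have h1 : |h 0 x - h 0 y| ≤ 1 := by
        rw [abs_le]; constructor <;> linarith [h01 x, h01 y]
      refine h1.trans ?_
      simp only [Nat.cast_zero, zero_mul, add_zero]
      rw [Real.rpow_neg hs0.le, inv_mul_eq_div, one_le_div (by positivity)]
      exact Real.rpow_le_rpow hs0.le (by linarith [Real.rpow_nonneg hW.le (1/p)]) hp0.le
    | succ q ih =>
      intro σ hs x y
      have hs0 : 0 < σ := by linarith
      have hW : 0 < V x + V y := add_pos (hV x) (hV y)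
      set v := (V x + V y) ^ (1 / p) with hv
      have hv0 : 0 < v := Real.rpow_pos_of_pos hW _
      have hvp : v ^ p = V x + V y := by
        rw [hv, ← Real.rpow_mul hW.le, one_div_mul_cancel hp0.ne', Real.rpow_one]
      have hlam : (σ + (q + 1 : ℕ) * κ) = σ + κ + q * κ := by push_cast; ring
      rw [hlam]
      set L := (σ + κ + q * κ) ^ (-p) with hL
      have hL0 : 0 ≤ L := by positivity
      have step : ∀ θ, 0 < θ → θ < 1 → ∀ x' y', |h q x' - h q y'| ≤
          L * (θ ^ (1 - p) * (σ + κ) ^ p) + L * (1 - θ) ^ (1 - p) * (V x' + V y') := by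
        intro θ h0 h1 x' y'
        have hW' : 0 < V x' + V y' := add_pos (hV x') (hV y')
        refine (ih (σ + κ) (by linarith) x' y').trans ?_
        have := conv_ineq p θ (σ + κ) ((V x' + V y') ^ (1 / p)) hp.le h0 h1 (by linarith)
          (by positivity)
        rw [← Real.rpow_mul hW'.le, one_div_mul_cancel hp0.ne', Real.rpow_one] at this
        rw [mul_assoc, ← mul_add]
        exact mul_le_mul_of_nonneg_left this hL0
      rw [hrec, hrec]
      by_cases hxy : x ∈ C ∧ y ∈ C
      · have h1t : 0 < 1 - θ0 := by linarith
        have := onestep (Q x) (Q y) ν V (fun z => (hV z).le) (hint x) (hint y) (h q) (hh q x)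
          (hh q y) _ _ (by positivity) (step θ0 hθ0 hθ1) (hM x hxy.1) (hM y hxy.2)
        refine this.trans ?_
        have hb := add_le_add (hB x hxy.1) (hB y hxy.2)
        have h2 := hσ σ hs
        have h3 : σ ^ p ≤ (σ + v) ^ p := Real.rpow_le_rpow hs0.le (by linarith) hp0.le
        have h4 : (1 - θ0) ^ (1 - p) * (∫ z, V z ∂(Q x) + ∫ z, V z ∂(Q y))
          ≤ (1 - θ0) ^ (1 - p) * (2 * B) := mul_le_mul_of_nonneg_left (by linarith) (by positivity)
        calc _ = L * ((1 - ν.real univ) * (θ0 ^ (1 - p) * (σ + κ) ^ p) + 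
                (1 - θ0) ^ (1 - p) * (∫ z, V z ∂(Q x) + ∫ z, V z ∂(Q y))) := by ring
          _ ≤ _ := mul_le_mul_of_nonneg_left (by linarith) hL0
      · have hd := hD x y hxy
        have hq0 : 0 ≤ ∫ z, V z ∂(Q x) + ∫ z, V z ∂(Q y) :=
          add_nonneg (integral_nonneg fun z => (hV z).le) (integral_nonneg fun z => (hV z).le)
        have hvr : (V x + V y) ^ (1 - 1 / p) = v ^ p / v := by
          rw [Real.rpow_sub hW, Real.rpow_one, hvp]
        rw [hvr, ← hvp] at hd
        have hcv : c ≤ v := by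
          have : c * (v ^ p / v) ≤ v ^ p := by linarith
          have h5 : 0 < v ^ p := by positivity
          rw [mul_div_assoc', div_le_iff₀ hv0] at this
          nlinarith
        have hκv : κ < v := lt_of_lt_of_le (by rw [hκ]; exact div_lt_self hc hp) hcv
        have bern : v ^ p - c * (v ^ p / v) ≤ (v - κ) ^ p := by
          have := one_add_mul_self_le_rpow_one_add (s := - (κ / v)) (p := p)
            (by rw [neg_le_neg_iff, div_le_one hv0]; exact hκv.le) hp.le
          have e : v - κ = v * (1 + -(κ / v)) := by field_simp; ring
          rw [e, Real.mul_rpow hv0.le (by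
            have : κ / v ≤ 1 := (div_le_one hv0).2 hκv.le
            linarith)]
          have := mul_le_mul_of_nonneg_left this (Real.rpow_nonneg hv0.le p)
          refine le_trans (le_of_eq ?_) this
          rw [hκ]; field_simp; ring
        have hb0 : 0 < v - κ := by linarith
        have ha0 : 0 < σ + κ := by linarith
        set θ := (σ + κ) / (σ + κ + (v - κ)) with hθ
        have ht0 : 0 < θ := by positivity
        have ht1 : θ < 1 := by rw [hθ, div_lt_one (by positivity)]; linarith
        have h1t : 0 < 1 - θ := by linarith
        have := onestep (Q x) (Q y) 0 V (fun z => (hV z).le) (hint x) (hint y) (h q) (hh q x)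
          (hh q y) _ _ (by positivity) (step θ ht0 ht1) (Measure.zero_le _) (Measure.zero_le _)
        refine this.trans ?_
        have ce := conv_eq p (σ + κ) (v - κ) ha0 hb0
        rw [← hθ] at ce
        have h4 : (1 - θ) ^ (1 - p) * (∫ z, V z ∂(Q x) + ∫ z, V z ∂(Q y))
          ≤ (1 - θ) ^ (1 - p) * (v - κ) ^ p :=
          mul_le_mul_of_nonneg_left (by linarith) (by positivity)
        calc _ = L * ((θ ^ (1 - p) * (σ + κ) ^ p) + 
                (1 - θ) ^ (1 - p) * (∫ z, V z ∂(Q x) + ∫ z, V z ∂(Q y))) := by simp; ring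
          _ ≤ L * ((θ ^ (1 - p) * (σ + κ) ^ p) + (1 - θ) ^ (1 - p) * (v - κ) ^ p) :=
            mul_le_mul_of_nonneg_left (by linarith) hL0
          _ = _ := by rw [ce]; ring_nf
  exact fun q => main q σ0 le_rfl

lemma measSet_simU (m : ℕ) (E : ℝ) : MeasurableSet (simU m E) := by
  unfold simU
  rw [ofPred_and, ofPred_forall]
  exact (MeasurableSet.iInter fun i => measurableSet_lt measurable_const (measurable_pi_apply i)).inter
    (measurableSet_lt (Finset.measurable_sum _ fun i _ => measurable_pi_apply i) measurable_const)

lemma emb_simU (m : ℕ) (E : ℝ) : MeasurableEmbedding (Subtype.val : Delta m E → Fin m → ℝ) :=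
  MeasurableEmbedding.subtype_coe (measSet_simU m E)

lemma Texch_val {m : ℕ} {E : ℝ} (i : Fin m) (u : ℝ) (hu : u ∈ Ioo (0:ℝ) 1) (x : Delta m E) :
    (Texch m E i u x).1 = T0 m E i u x.1 := by
  rw [Texch, dif_pos hu]

lemma meas_T0 (m : ℕ) (E : ℝ) (i : Fin m) :
    Measurable (fun q : ℝ × (Fin m → ℝ) => T0 m E i q.1 q.2) := by
  rw [measurable_pi_iff]
  intro j
  by_cases h : j = i
  · subst h
    simp only [T0, Function.update_self]
    fun_prop
  · simp only [T0, Function.update_of_ne h]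
    fun_prop

lemma meas_Texch (m : ℕ) (E : ℝ) (i : Fin m) :
    Measurable (fun q : ℝ × Delta m E => Texch m E i q.1 q.2) := by
  rw [← (emb_simU m E).measurable_comp_iff]
  have : (Subtype.val ∘ fun q : ℝ × Delta m E => Texch m E i q.1 q.2)
      = fun q => if q.1 ∈ Ioo (0:ℝ) 1 then T0 m E i q.1 q.2.1 else q.2.1 := by
    funext q
    simp only [Function.comp, Texch]
    split_ifs <;> rfl
  rw [this]
  refine Measurable.ite (measurable_fst measurableSet_Ioo) ?_ (measurable_subtype_coe.comp measurable_snd)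
  exact (meas_T0 m E i).comp (measurable_fst.prodMk (measurable_subtype_coe.comp measurable_snd))

lemma Lam_pos {m : ℕ} (hm : 1 ≤ m) {E : ℝ} (hE : 0 < E) : 0 < Lam m E := by
  have : (0:ℝ) < m := by exact_mod_cast hm
  exact Real.sqrt_pos.2 (by positivity)

lemma tank_pos {m : ℕ} {E : ℝ} (x : Delta m E) : 0 < tank m E x := sub_pos.2 x.2.2

lemma rate_le {m : ℕ} {E : ℝ} (x : Delta m E) : jumpRate m E x ≤ Lam m E := by
  unfold jumpRate Lam
  apply Real.le_sqrt_of_sq_le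
  have := sq_sum_le_card_mul_sum_sq (s := Finset.univ) (f := fun i => Real.sqrt (x.1 i))
  simp only [Finset.card_univ, Fintype.card_fin] at this
  refine this.trans ?_
  have h2 : ∑ i, Real.sqrt (x.1 i) ^ 2 = ∑ i, x.1 i :=
    Finset.sum_congr rfl fun i _ => Real.sq_sqrt (x.2.1 i).le
  rw [h2]
  exact mul_le_mul_of_nonneg_left x.2.2.le (by positivity)

lemma rate_nonneg {m : ℕ} {E : ℝ} (x : Delta m E) : 0 ≤ jumpRate m E x :=
  Finset.sum_nonneg fun i _ => Real.sqrt_nonneg _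

lemma lint_ustep {m : ℕ} {E : ℝ} (x : Delta m E) (F : Delta m E → ENNReal) (hF : Measurable F) :
    ∫⁻ z, F z ∂(ustep m E x) = ENNReal.ofReal (1 - jumpRate m E x / Lam m E) * F x
      + (ENNReal.ofReal (Lam m E))⁻¹ * ∑ i, ENNReal.ofReal (Real.sqrt (x.1 i)) *
        ∫⁻ u in Ioo (0:ℝ) 1, F (Texch m E i u x) := by
  unfold ustep
  rw [lintegral_add_measure, lintegral_smul_measure, lintegral_smul_measure, lintegral_dirac' _ hF,
    lintegral_sum_measure, tsum_fintype]
  simp only [smul_eq_mul]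
  congr 2
  refine Finset.sum_congr rfl fun i _ => ?_
  rw [lintegral_smul_measure, smul_eq_mul, lintegral_map hF]
  · rfl
  · exact (meas_Texch m E i).comp (measurable_id.prodMk measurable_const)

lemma weights {m : ℕ} (hm : 1 ≤ m) {E : ℝ} (hE : 0 < E) (x : Delta m E) :
    ENNReal.ofReal (1 - jumpRate m E x / Lam m E) 
      + (ENNReal.ofReal (Lam m E))⁻¹ * ∑ i, ENNReal.ofReal (Real.sqrt (x.1 i)) = 1 := by
  have hL := Lam_pos hm hE
  rw [← ENNReal.ofReal_sum_of_nonneg fun i _ => Real.sqrt_nonneg _, ← ENNReal.ofReal_inv_of_pos hL,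
    ← ENNReal.ofReal_mul (by positivity), ← ENNReal.ofReal_add]
  · rw [show (1 - jumpRate m E x / Lam m E + (Lam m E)⁻¹ * ∑ i, Real.sqrt (x.1 i)) = 1 by
      unfold jumpRate; ring]
    simp
  · rw [sub_nonneg, div_le_one hL]; exact rate_le x
  · exact mul_nonneg (by positivity) (rate_nonneg x)

lemma prob_ustep {m : ℕ} (hm : 1 ≤ m) {E : ℝ} (hE : 0 < E) (x : Delta m E) :
    IsProbabilityMeasure (ustep m E x) := by
  constructor
  have := lint_ustep x (fun _ => 1) measurable_const
  simp only [lintegral_one, mul_one] at this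
  rw [this, ← weights hm hE x]
  simp

lemma meas_sqrt_coord {m : ℕ} {E : ℝ} (i : Fin m) :
    Measurable (fun x : Delta m E => ENNReal.ofReal (Real.sqrt (x.1 i))) :=
  ENNReal.measurable_ofReal.comp (Real.continuous_sqrt.measurable.comp
    ((measurable_pi_apply i).comp measurable_subtype_coe))

lemma meas_hold {m : ℕ} {E : ℝ} :
    Measurable (fun x : Delta m E => ENNReal.ofReal (1 - jumpRate m E x / Lam m E)) := by
  refine ENNReal.measurable_ofReal.comp (measurable_const.sub (Measurable.div_const ?_ _))
  unfold jumpRate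
  exact Finset.measurable_sum _ fun i _ => (Real.continuous_sqrt.measurable.comp
    ((measurable_pi_apply i).comp measurable_subtype_coe))

lemma meas_jumpint {m : ℕ} {E : ℝ} (i : Fin m) (F : Delta m E → ENNReal) (hF : Measurable F) :
    Measurable (fun x : Delta m E => ∫⁻ u in Ioo (0:ℝ) 1, F (Texch m E i u x)) :=
  Measurable.lintegral_prod_left' (f := fun q : ℝ × Delta m E => F (Texch m E i q.1 q.2))
    (hF.comp (meas_Texch m E i))

lemma meas_ustep (m : ℕ) (E : ℝ) : Measurable (ustep m E) := by
  refine Measure.measurable_of_measurable_coe _ fun A hA => ?_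
  have : (fun x => ustep m E x A) = fun x => 
      ENNReal.ofReal (1 - jumpRate m E x / Lam m E) * A.indicator 1 x
      + (ENNReal.ofReal (Lam m E))⁻¹ * ∑ i, ENNReal.ofReal (Real.sqrt (x.1 i)) *
        ∫⁻ u in Ioo (0:ℝ) 1, A.indicator 1 (Texch m E i u x) := by
    funext x
    rw [← lint_ustep x _ (measurable_one.indicator hA), lintegral_indicator_one hA]
  rw [this]
  refine (meas_hold.mul (measurable_one.indicator hA)).add (Measurable.const_mul ?_ _)
  exact Finset.measurable_sum _ fun i _ => (meas_sqrt_coord i).mul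
    (meas_jumpint i _ (measurable_one.indicator hA))

lemma meas_iter (m : ℕ) (E : ℝ) (n : ℕ) : Measurable (ustepIter m E n) := by
  induction n with
  | zero => exact Measure.measurable_dirac
  | succ n ih => exact (Measure.measurable_bind' ih).comp (meas_ustep m E)

lemma lint_iter_succ {m : ℕ} {E : ℝ} (n : ℕ) (x : Delta m E) (F : Delta m E → ENNReal)
    (hF : Measurable F) : ∫⁻ z, F z ∂(ustepIter m E (n+1) x)
      = ∫⁻ z, (∫⁻ w, F w ∂(ustepIter m E n z)) ∂(ustep m E x) := by
  rw [ustepIter, Measure.lintegral_bind (meas_iter m E n).aemeasurable hF.aemeasurable]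

lemma meas_lint_iter {m : ℕ} {E : ℝ} (n : ℕ) (F : Delta m E → ENNReal)
    (hF : Measurable F) : Measurable fun z => ∫⁻ w, F w ∂(ustepIter m E n z) :=
  (Measure.measurable_lintegral hF).comp (meas_iter m E n)

lemma lint_iter_add {m : ℕ} {E : ℝ} (n k : ℕ) (x : Delta m E) (F : Delta m E → ENNReal)
    (hF : Measurable F) : ∫⁻ z, F z ∂(ustepIter m E (n+k) x)
      = ∫⁻ z, (∫⁻ w, F w ∂(ustepIter m E k z)) ∂(ustepIter m E n x) := by
  induction n generalizing x with
  | zero => 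
    rw [Nat.zero_add, ustepIter, lintegral_dirac' _ (meas_lint_iter k F hF)]
  | succ n ih =>
    rw [Nat.add_right_comm, lint_iter_succ _ _ _ hF, lint_iter_succ _ _ _ (meas_lint_iter k F hF)]
    simp_rw [ih]

lemma prob_iter {m : ℕ} (hm : 1 ≤ m) {E : ℝ} (hE : 0 < E) (n : ℕ) (x : Delta m E) :
    IsProbabilityMeasure (ustepIter m E n x) := by
  induction n generalizing x with
  | zero => rw [ustepIter]; infer_instance
  | succ n ih =>
    constructor
    have := lint_iter_succ n x (fun _ => 1) measurable_const
    have h2 := prob_ustep hm hE x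
    simpa using this

lemma sq_subst (R : ℝ) (f : ℝ → ENNReal) (hf : Measurable f) :
    ∫⁻ y in Ioo 0 (R ^ 2), ENNReal.ofReal (y ^ (-(1/2) : ℝ)) * f y
      = 2 * ∫⁻ w in Ioo 0 |R|, f (w ^ 2) := by
  have him : (fun w : ℝ => w ^ 2) '' Ioo 0 |R| = Ioo 0 (R ^ 2) := by
    ext y
    constructor
    · rintro ⟨w, ⟨h0, h1⟩, rfl⟩
      refine ⟨by positivity, ?_⟩
      rw [← sq_abs R]
      exact pow_lt_pow_left₀ h1 h0.le (by norm_num)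
    · rintro ⟨h0, h1⟩
      refine ⟨Real.sqrt y, ⟨Real.sqrt_pos.2 h0, ?_⟩, Real.sq_sqrt h0.le⟩
      rw [← Real.sqrt_sq_eq_abs]
      exact Real.sqrt_lt_sqrt h0.le h1
  rw [← him, lintegral_image_eq_lintegral_abs_deriv_mul measurableSet_Ioo (f' := fun w => 2 * w)]
  · rw [← lintegral_const_mul _ (by fun_prop)]
    refine setLIntegral_congr_fun measurableSet_Ioo fun w hw => ?_
    have hw0 : 0 < w := hw.1
    rw [← mul_assoc, ← ENNReal.ofReal_mul (abs_nonneg _)]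
    congr 1
    rw [abs_of_pos (by positivity), ← Real.rpow_natCast, ← Real.rpow_mul hw0.le]
    norm_num
    rw [Real.rpow_neg_one]
    field_simp
  · intro w _
    simpa using (hasDerivAt_pow 2 w).hasDerivWithinAt
  · intro a ha b hb hab
    exact (pow_left_inj₀ ha.1.le hb.1.le (by norm_num)).1 hab

lemma scale_subst (X : ℝ) (hX : 0 < X) (f : ℝ → ENNReal) :
    ENNReal.ofReal (Real.sqrt X) * ∫⁻ u in Ioo (0:ℝ) 1, f (u ^ 2 * X)
      = ∫⁻ w in Ioo 0 (Real.sqrt X), f (w ^ 2) := by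
  have hs : 0 < Real.sqrt X := Real.sqrt_pos.2 hX
  have him : (fun u : ℝ => Real.sqrt X * u) '' Ioo 0 1 = Ioo 0 (Real.sqrt X) := by
    rw [Set.image_mul_left_Ioo hs]; simp
  rw [← him, lintegral_image_eq_lintegral_abs_deriv_mul measurableSet_Ioo
    (f' := fun _ => Real.sqrt X)]
  · rw [← lintegral_const_mul' _ _ ENNReal.ofReal_ne_top]
    refine setLIntegral_congr_fun measurableSet_Ioo fun w hw => ?_
    rw [abs_of_pos hs, mul_pow, Real.sq_sqrt hX.le, mul_comm X]
  · intro w _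
    simpa using ((hasDerivAt_id w).const_mul (Real.sqrt X)).hasDerivWithinAt
  · intro a _ b _ hab
    exact mul_left_cancel₀ hs.ne' hab

lemma refl_subst (a b s : ℝ) (g : ℝ → ENNReal) :
    ∫⁻ y in Ioo a b, g (s - y) = ∫⁻ z in Ioo (s - b) (s - a), g z := by
  rw [← lintegral_indicator measurableSet_Ioo, ← lintegral_indicator measurableSet_Ioo,
    ← lintegral_sub_left_eq_self (fun z => (Ioo (s - b) (s - a)).indicator g z) s]
  refine lintegral_congr fun y => ?_
  by_cases h : y ∈ Ioo a b
  · rw [indicator_of_mem h, indicator_of_mem]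
    exact ⟨by linarith [h.2], by linarith [h.1]⟩
  · rw [indicator_of_notMem h, indicator_of_notMem]
    intro h'
    exact h ⟨by linarith [h'.2], by linarith [h'.1]⟩

lemma gibbs1D (s : ℝ) (hs : 0 < s) (f : ℝ → ENNReal) (hf : Measurable f) :
    ∫⁻ z in Ioo 0 s, ENNReal.ofReal ((s - z) ^ (-(1/2) : ℝ)) * (ENNReal.ofReal (Real.sqrt z) *
      ∫⁻ u in Ioo (0:ℝ) 1, f (s - u ^ 2 * z))
    = ∫⁻ z in Ioo 0 s, ENNReal.ofReal ((s - z) ^ (-(1/2) : ℝ)) *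
        (ENNReal.ofReal (Real.sqrt z) * f z) := by
  have e1 : ∀ z ∈ Ioo 0 s, (ENNReal.ofReal ((s - z) ^ (-(1/2) : ℝ)) *
      (ENNReal.ofReal (Real.sqrt z) * ∫⁻ u in Ioo (0:ℝ) 1, f (s - u ^ 2 * z)))
      = (fun y => ENNReal.ofReal (y ^ (-(1/2) : ℝ)) *
        ∫⁻ w in Ioo 0 (Real.sqrt (s - y)), f (s - w ^ 2)) (s - z) := by
    intro z hz
    have := scale_subst z hz.1 (fun y => f (s - y))
    simp only [this, sub_sub_cancel]
  have e2 : ∀ z ∈ Ioo 0 s, (ENNReal.ofReal ((s - z) ^ (-(1/2) : ℝ)) *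
      (ENNReal.ofReal (Real.sqrt z) * f z))
      = (fun y => ENNReal.ofReal (y ^ (-(1/2) : ℝ)) *
        ∫⁻ w in Ioo 0 (Real.sqrt (s - y)), f (s - y)) (s - z) := by
    intro z hz
    simp [mul_comm]
  have mind : Measurable fun q : ℝ × ℝ => (Ioo 0 (Real.sqrt (s - q.1))).indicator
      (fun w => f (s - w ^ 2)) q.2 := by
    have : (fun q : ℝ × ℝ => (Ioo 0 (Real.sqrt (s - q.1))).indicator (fun w => f (s - w ^ 2)) q.2)
      = {q : ℝ × ℝ | 0 < q.2 ∧ q.2 < Real.sqrt (s - q.1)}.indicator (fun q => f (s - q.2 ^ 2)) := by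
      funext q
      simp [indicator]
    rw [this]
    refine Measurable.indicator (by fun_prop) ?_
    exact (measurableSet_lt measurable_const measurable_snd).inter
      (measurableSet_lt measurable_snd (by fun_prop))
  have m1 : Measurable fun y => ∫⁻ w in Ioo 0 (Real.sqrt (s - y)), f (s - w ^ 2) := by
    simp_rw [← lintegral_indicator measurableSet_Ioo]
    exact mind.lintegral_prod_right'
  have m2 : Measurable fun y => ∫⁻ w in Ioo 0 (Real.sqrt (s - y)), f (s - y) := by
    simp only [lintegral_const, Measure.restrict_apply_univ, Real.volume_Ioo]
    fun_prop
  rw [setLIntegral_congr_fun measurableSet_Ioo e1, setLIntegral_congr_fun measurableSet_Ioo e2,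
    refl_subst 0 s s (fun y => ENNReal.ofReal (y ^ (-(1/2) : ℝ)) *
        ∫⁻ w in Ioo 0 (Real.sqrt (s - y)), f (s - w ^ 2)),
    refl_subst 0 s s (fun y => ENNReal.ofReal (y ^ (-(1/2) : ℝ)) *
        ∫⁻ w in Ioo 0 (Real.sqrt (s - y)), f (s - y)), sub_self, sub_zero]
  have hss : Real.sqrt s ^ 2 = s := Real.sq_sqrt hs.le
  have k1 := sq_subst (Real.sqrt s) _ m1
  have k2 := sq_subst (Real.sqrt s) _ m2
  rw [hss] at k1 k2
  rw [k1, k2]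
  congr 1
  rw [abs_of_nonneg (Real.sqrt_nonneg s)]
  simp_rw [← lintegral_indicator measurableSet_Ioo]
  have key : ∀ w w' : ℝ, (Ioo 0 √s).indicator (fun w => (Ioo 0 √(s - w ^ 2)).indicator
      (fun w' => f (s - w' ^ 2)) w') w = (Ioo 0 √s).indicator (fun w' => 
        (Ioo 0 √(s - w' ^ 2)).indicator (fun _ => f (s - w' ^ 2)) w) w' := by
    intro w w'
    have hiff : (w ∈ Ioo 0 √s ∧ w' ∈ Ioo 0 √(s - w ^ 2)) ↔
        (w' ∈ Ioo 0 √s ∧ w ∈ Ioo 0 √(s - w' ^ 2)) := by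
      simp only [mem_Ioo]
      constructor
      · rintro ⟨⟨a, b⟩, c, d⟩
        rw [Real.lt_sqrt c.le] at d
        refine ⟨⟨c, ?_⟩, a, ?_⟩
        · rw [Real.lt_sqrt c.le]; nlinarith
        · rw [Real.lt_sqrt a.le]; linarith
      · rintro ⟨⟨c, _⟩, a, d⟩
        rw [Real.lt_sqrt a.le] at d
        refine ⟨⟨a, ?_⟩, c, ?_⟩
        · rw [Real.lt_sqrt a.le]; nlinarith
        · rw [Real.lt_sqrt c.le]; linarith
    simp only [indicator]
    rw [← ite_and, ← ite_and]
    by_cases hh : w ∈ Ioo 0 √s ∧ w' ∈ Ioo 0 √(s - w ^ 2)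
    · rw [if_pos hh, if_pos (hiff.1 hh)]
    · rw [if_neg hh, if_neg (fun h => hh (hiff.2 h))]
  have out : ∀ (G : ℝ → ℝ → ENNReal), (∫⁻ w, (Ioo 0 √s).indicator (fun w => ∫⁻ w', G w w') w)
      = ∫⁻ w, ∫⁻ w', (Ioo 0 √s).indicator (fun w => G w w') w := by
    intro G
    refine lintegral_congr fun w => ?_
    by_cases h : w ∈ Ioo 0 √s <;> simp only [indicator, h, if_true, if_false, lintegral_zero]
  rw [out, out]
  have mm : Measurable (Function.uncurry fun w w' : ℝ => (Ioo 0 √s).indicator (fun w => 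
      (Ioo 0 √(s - w ^ 2)).indicator (fun w' => f (s - w' ^ 2)) w') w) := by
    have : (Function.uncurry fun w w' : ℝ => (Ioo 0 √s).indicator (fun w => 
      (Ioo 0 √(s - w ^ 2)).indicator (fun w' => f (s - w' ^ 2)) w') w) = 
      (Prod.fst ⁻¹' (Ioo 0 √s)).indicator (fun q : ℝ × ℝ => (Ioo 0 (Real.sqrt (s - q.1 ^ 2))).indicator
      (fun w => f (s - w ^ 2)) q.2) := by
      funext q
      simp [indicator, Function.uncurry]
    rw [this]
    refine Measurable.indicator ?_ (measurable_fst measurableSet_Ioo)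
    exact mind.comp (f := fun q : ℝ × ℝ => (q.1 ^ 2, q.2)) (by fun_prop)
  rw [lintegral_lintegral_swap mm.aemeasurable]
  simp_rw [key]

noncomputable def extF {m : ℕ} {E : ℝ} (F : Delta m E → ENNReal) : (Fin m → ℝ) → ENNReal :=
  Function.extend Subtype.val F 0

lemma extF_mem {m : ℕ} {E : ℝ} (F : Delta m E → ENNReal) (x : Delta m E) : extF F x.1 = F x :=
  Subtype.val_injective.extend_apply F 0 x

lemma meas_extF {m : ℕ} {E : ℝ} (F : Delta m E → ENNReal) (hF : Measurable F) :
    Measurable (extF F) := (emb_simU m E).measurable_extend hF measurable_zero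

lemma sum_upd {m : ℕ} (x : Fin m → ℝ) (i : Fin m) (z : ℝ) :
    ∑ j, Function.update x i z j = ∑ j, x j - x i + z := by
  rw [Finset.sum_update_of_mem (Finset.mem_univ i), ← Finset.erase_eq,
    Finset.sum_erase_eq_sub (Finset.mem_univ i)]
  ring

lemma upd_mem {m : ℕ} {E : ℝ} (x : Fin m → ℝ) (i : Fin m) (z : ℝ) :
    Function.update x i z ∈ simU m E ↔ 
      (∀ j, j ≠ i → 0 < x j) ∧ z ∈ Ioo 0 (E - ∑ j, x j + x i) := by
  unfold simU
  rw [mem_ofPred_eq, sum_upd]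
  constructor
  · rintro ⟨h1, h2⟩
    refine ⟨fun j hj => by simpa [hj] using h1 j, by simpa using h1 i, by linarith⟩
  · rintro ⟨h1, h2, h3⟩
    refine ⟨fun j => ?_, by linarith⟩
    by_cases hj : j = i
    · subst hj; simpa using h2
    · simpa [hj] using h1 j hj

lemma T0_upd {m : ℕ} {E : ℝ} (x : Fin m → ℝ) (i : Fin m) (u z : ℝ) :
    T0 m E i u (Function.update x i z)
      = Function.update x i (E - ∑ j, x j + x i - u ^ 2 * z) := by
  unfold T0
  rw [sum_upd, Function.update_idem, Function.update_self]
  congr 1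
  ring

lemma meas_upd_comp {m : ℕ} (f : (Fin m → ℝ) → ENNReal) (hf : Measurable f) (x : Fin m → ℝ)
    (i : Fin m) : Measurable fun z => f (Function.update x i z) :=
  hf.comp (measurable_update x)

noncomputable def c0 (m : ℕ) (E : ℝ) : ENNReal :=
  (ENNReal.ofReal (Lam m E))⁻¹ * (2⁻¹ * ENNReal.ofReal (E ^ (-(1/2) : ℝ)))

lemma step1 {m : ℕ} {E : ℝ} (hE : 0 < E) (x : Delta m E) (i : Fin m)
    (F : Delta m E → ENNReal) (hF : Measurable F) :
    c0 m E * ∫⁻ y in Ioo 0 (x.1 i), extF F (Function.update x.1 i (E - ∑ j, x.1 j + x.1 i - y)) ≤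
      ∫⁻ z, F z ∂(ustep m E x) := by
  rw [lint_ustep x F hF]
  refine le_trans ?_ le_add_self
  unfold c0
  rw [mul_assoc]
  gcongr
  refine le_trans ?_ (Finset.single_le_sum (f := fun i => ENNReal.ofReal (Real.sqrt (x.1 i)) *
        ∫⁻ u in Ioo (0:ℝ) 1, F (Texch m E i u x)) (fun _ _ => zero_le) (Finset.mem_univ i))
  have hxi := x.2.1 i
  set s := E - ∑ j, x.1 j + x.1 i with hs
  have e1 : ∫⁻ u in Ioo (0:ℝ) 1, F (Texch m E i u x) =
      ∫⁻ u in Ioo (0:ℝ) 1, (fun y => extF F (Function.update x.1 i (s - y))) (u ^ 2 * x.1 i) := by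
    refine setLIntegral_congr_fun measurableSet_Ioo fun u hu => ?_
    simp only []
    rw [← extF_mem F, Texch_val i u hu]
    congr 1
    have := T0_upd (E := E) x.1 i u (x.1 i)
    rwa [Function.update_eq_self] at this
  have e3 := scale_subst _ hxi (fun y => extF F (Function.update x.1 i (s - y)))
  rw [e1, e3]
  have hm : Measurable fun y => extF F (Function.update x.1 i (s - y)) :=
    (meas_upd_comp _ (meas_extF F hF) x.1 i).comp (measurable_const.sub measurable_id)
  have := sq_subst (Real.sqrt (x.1 i)) _ hm
  rw [Real.sq_sqrt hxi.le, abs_of_nonneg (Real.sqrt_nonneg _)] at this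
  have h2 : ∫⁻ w in Ioo 0 √(x.1 i), extF F (Function.update x.1 i (s - w ^ 2)) = 2⁻¹ *
      ∫⁻ y in Ioo 0 (x.1 i), ENNReal.ofReal (y ^ (-(1/2) : ℝ)) *
        extF F (Function.update x.1 i (s - y)) := by
    rw [this, ← mul_assoc, ENNReal.inv_mul_cancel (by norm_num) (by norm_num), one_mul]
  rw [h2, mul_assoc]
  gcongr
  rw [← lintegral_const_mul _ hm]
  refine setLIntegral_mono' measurableSet_Ioo fun y hy => ?_
  refine mul_le_mul_left (ENNReal.ofReal_le_ofReal ?_) _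
  refine Real.rpow_le_rpow_of_nonpos hy.1 ?_ (by norm_num)
  have := Finset.single_le_sum (f := x.1) (fun j _ => (x.2.1 j).le) (Finset.mem_univ i)
  linarith [x.2.2, hy.2]

lemma step2 {m : ℕ} {E : ℝ} (hE : 0 < E) (ε : ℝ) (x : Delta m E) (i : Fin m)
    (hx : 2 * ε ≤ x.1 i)
    (F : Delta m E → ENNReal) (hF : Measurable F) :
    (c0 m E * c0 m E * ENNReal.ofReal ε) * ∫⁻ z in Ioo ε (2 * ε), extF F (Function.update x.1 i z) ≤
      ∫⁻ z, (∫⁻ w, F w ∂(ustep m E z)) ∂(ustep m E x) := by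
  have hG : Measurable fun z => ∫⁻ w, F w ∂(ustep m E z) :=
    (Measure.measurable_lintegral hF).comp (meas_ustep m E)
  refine le_trans ?_ (step1 hE x i _ hG)
  have hxi := x.2.1 i
  have hy := x.2.2
  set s := E - ∑ j, x.1 j + x.1 i with hs
  rcases le_or_gt ε 0 with hε | hε
  · simp [ENNReal.ofReal_of_nonpos hε]
  rw [mul_assoc, mul_assoc]
  gcongr
  have h1 : ∫⁻ y in Ioo 0 ε, c0 m E * ∫⁻ z in Ioo ε (2 * ε), extF F (Function.update x.1 i z) ≤
     ∫⁻ y in Ioo 0 ε, extF (fun z => ∫⁻ w, F w ∂(ustep m E z)) (Function.update x.1 i (s - y)) := by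
    refine setLIntegral_mono' measurableSet_Ioo fun y hy => ?_
    have hp : Function.update x.1 i (s - y) ∈ simU m E := by
      rw [upd_mem]
      exact ⟨fun j _ => x.2.1 j, by linarith [hy.2], by linarith [hy.1]⟩
    rw [extF_mem _ (⟨_, hp⟩ : Delta m E)]
    refine le_trans ?_ (step1 hE (⟨_, hp⟩ : Delta m E) i F hF)
    simp only [sum_upd, Function.update_self, Function.update_idem]
    refine mul_le_mul_right ?_ _
    have e : ∀ y', E - (∑ j, x.1 j - x.1 i + (s - y)) + (s - y) - y' = s - y' := fun y' => by
      rw [hs]; ring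
    simp only [e]
    rw [refl_subst 0 (s - y) s (fun z => extF F (Function.update x.1 i z))]
    refine lintegral_mono_set (Ioo_subset_Ioo ?_ ?_)
    · linarith [hy.2]
    · linarith
  refine le_trans (le_of_eq ?_) (h1.trans (lintegral_mono_set (Ioo_subset_Ioo le_rfl (by linarith))))
  rw [setLIntegral_const, Real.volume_Ioo, sub_zero]
  ring

lemma stepS {m : ℕ} {E : ℝ} (hE : 0 < E) (ε : ℝ) (hε : 0 < ε) (F : Delta m E → ENNReal)
    (hF : Measurable F) (S : Finset (Fin m)) :
    ∀ x : Delta m E, (∀ i ∈ S, 2 * ε ≤ x.1 i) →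
    (c0 m E * c0 m E * ENNReal.ofReal ε) ^ S.card * 
      lmarginal (fun _ => volume.restrict (Ioo ε (2 * ε))) S (extF F) x.1 ≤
      ∫⁻ z, F z ∂(ustepIter m E (2 * S.card) x) := by
  induction S using Finset.induction_on with
  | empty =>
    intro x _
    simp only [Finset.card_empty, pow_zero, lmarginal_empty, one_mul, mul_zero, ustepIter]
    rw [lintegral_dirac' _ hF, extF_mem]
  | insert i S hi ih =>
    intro x hx
    rw [Finset.card_insert_of_notMem hi, lmarginal_insert _ (meas_extF F hF) hi]
    have e : 2 * (S.card + 1) = 2 * S.card + 1 + 1 := by ring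
    rw [e, lint_iter_succ _ _ _ hF]
    simp_rw [lint_iter_succ _ _ _ hF]
    refine le_trans ?_ (step2 hE ε x i (hx i (Finset.mem_insert_self i S)) _
      (meas_lint_iter (2 * S.card) F hF))
    rw [pow_succ', mul_assoc]
    gcongr
    rw [← lintegral_const_mul']
    · refine setLIntegral_mono' measurableSet_Ioo fun z hz => ?_
      have hp : Function.update x.1 i z ∈ simU m E := by
        rw [upd_mem]
        refine ⟨fun j _ => x.2.1 j, by linarith [hz.1], ?_⟩
        linarith [hz.2, x.2.2, hx i (Finset.mem_insert_self i S)]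
      rw [extF_mem _ (⟨_, hp⟩ : Delta m E)]
      refine ih ⟨_, hp⟩ fun j hj => ?_
      have : j ≠ i := fun h => hi (h ▸ hj)
      simpa [this] using hx j (Finset.mem_insert_of_mem hj)
    · refine ENNReal.pow_ne_top (ENNReal.mul_ne_top (ENNReal.mul_ne_top ?_ ?_) ENNReal.ofReal_ne_top) <;>
      · have hm : 1 ≤ m := i.pos
        refine ENNReal.mul_ne_top ?_ (ENNReal.mul_ne_top (by simp) ENNReal.ofReal_ne_top)
        simpa using Lam_pos hm hE

lemma minorization {m : ℕ} (hm : 1 ≤ m) {E : ℝ} (hE : 0 < E) (ε : ℝ) (hε : 0 < ε)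
    (hεE : 2 * ε * m ≤ E) : ∃ ν : Measure (Delta m E), ν univ ≠ 0 ∧
      ∀ x : Delta m E, (∀ i, 2 * ε ≤ x.1 i) → ν ≤ ustepIter m E (2 * m) x := by
  set μ : Measure (Fin m → ℝ) := Measure.pi (fun _ => volume.restrict (Ioo ε (2 * ε))) with hμ
  refine ⟨(c0 m E * c0 m E * ENNReal.ofReal ε) ^ m • Measure.comap Subtype.val μ, ?_, ?_⟩
  · rw [Measure.smul_apply, smul_eq_mul]
    have hL := Lam_pos hm hE
    have hc0 : c0 m E ≠ 0 := by
      unfold c0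
      refine mul_ne_zero (by simp) (mul_ne_zero (by simp) ?_)
      simp only [ne_eq, ENNReal.ofReal_eq_zero, not_le]
      positivity
    refine mul_ne_zero (pow_ne_zero _ (mul_ne_zero (mul_ne_zero hc0 hc0) (by simpa using hε))) ?_
    rw [(emb_simU m E).comap_apply, image_univ, Subtype.range_coe]
    have hsub : Set.pi univ (fun _ : Fin m => Ioo ε (2 * ε)) ⊆ simU m E := by
      intro z hz
      have hz' : ∀ i, z i ∈ Ioo ε (2 * ε) := fun i => hz i (mem_univ i)
      refine ⟨fun i => hε.trans (hz' i).1, ?_⟩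
      have : Nonempty (Fin m) := ⟨⟨0, hm⟩⟩
      calc ∑ i, z i < ∑ i : Fin m, 2 * ε :=
            Finset.sum_lt_sum_of_nonempty Finset.univ_nonempty fun i _ => (hz' i).2
        _ = 2 * ε * m := by simp; ring
        _ ≤ E := hεE
    refine ne_of_gt (lt_of_lt_of_le ?_ (measure_mono hsub))
    rw [hμ, Measure.pi_pi, pos_iff_ne_zero, Finset.prod_ne_zero_iff]
    intro i _
    rw [Measure.restrict_apply measurableSet_Ioo, inter_self, Real.volume_Ioo]
    simp; linarith
  · intro x hx
    refine Measure.le_iff.2 fun A hA => ?_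
    have h1 := stepS hE ε hε (A.indicator 1) (measurable_one.indicator hA) Finset.univ x
      (fun i _ => hx i)
    rw [lintegral_indicator_one hA, Finset.card_univ, Fintype.card_fin, lmarginal_univ] at h1
    refine le_trans (le_of_eq ?_) h1
    rw [Measure.smul_apply, smul_eq_mul]
    congr 1
    rw [← hμ, (emb_simU m E).comap_apply]
    have : extF (A.indicator 1) = (Subtype.val '' A).indicator 1 := by
      funext z
      by_cases hz : z ∈ simU m E
      · rw [extF_mem _ (⟨z, hz⟩ : Delta m E)]
        by_cases h : (⟨z, hz⟩ : Delta m E) ∈ A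
        · rw [indicator_of_mem h, indicator_of_mem (mem_image_of_mem Subtype.val h)]; rfl
        · rw [indicator_of_notMem h, indicator_of_notMem]
          rintro ⟨w, hw, rfl⟩; exact h hw
      · rw [indicator_of_notMem, extF, Function.extend_apply']
        · rfl
        · rintro ⟨w, rfl⟩; exact hz w.2
        · rintro ⟨w, _, rfl⟩; exact hz w.2
    rw [this, lintegral_indicator_one ((emb_simU m E).measurableSet_image.2 hA)]

lemma extF_not_mem {m : ℕ} {E : ℝ} (F : Delta m E → ENNReal) (x : Fin m → ℝ) (hx : x ∉ simU m E) :
    extF F x = 0 := by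
  unfold extF
  rw [Function.extend_apply']
  · rfl
  · rintro ⟨a, rfl⟩
    exact hx a.2

lemma lint_lebU {m : ℕ} {E : ℝ} (F : Delta m E → ENNReal) :
    ∫⁻ x, F x ∂(lebU m E) = ∫⁻ x, extF F x := by
  have h := lintegral_subtype_comap (μ := (volume : Measure (Fin m → ℝ))) (measSet_simU m E) (extF F)
  simp only [extF_mem] at h
  unfold lebU
  rw [h, setLIntegral_eq_of_support_subset]
  intro x hx
  by_contra h
  exact hx (extF_not_mem F x h)

lemma slice_eq {m : ℕ} {E : ℝ} (i : Fin m) (F G : Delta m E → ENNReal) (hF : Measurable F)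
    (hG : Measurable G)
    (h : ∀ x : Delta m E, ∫⁻ z in Ioo 0 (tank m E x + x.1 i), extF F (Function.update x.1 i z)
      = ∫⁻ z in Ioo 0 (tank m E x + x.1 i), extF G (Function.update x.1 i z)) :
    ∫⁻ x, F x ∂(lebU m E) = ∫⁻ x, G x ∂(lebU m E) := by
  rw [lint_lebU, lint_lebU, volume_pi]
  refine lintegral_eq_of_lmarginal_eq {i} (meas_extF F hF) (meas_extF G hG) ?_
  rw [lmarginal_singleton, lmarginal_singleton]
  funext x
  by_cases hx : ∃ z, Function.update x i z ∈ simU m E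
  · obtain ⟨z, hz⟩ := hx
    have := h ⟨_, hz⟩
    simp only [Function.update_idem, tank, sum_upd, Function.update_self] at this
    have hs : E - (∑ j, x j - x i + z) + z = E - ∑ j, x j + x i := by ring
    rw [hs] at this
    rw [setLIntegral_eq_of_support_subset, setLIntegral_eq_of_support_subset] at this
    · exact this
    · intro w hw
      by_contra hc
      refine hw (extF_not_mem _ _ fun h => hc ((upd_mem x i w).1 h).2)
    · intro w hw
      by_contra hc
      refine hw (extF_not_mem _ _ fun h => hc ((upd_mem x i w).1 h).2)
  · push Not at hx
    simp [extF_not_mem _ _ (hx _)]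

lemma upd_memD {m : ℕ} {E : ℝ} (x : Delta m E) (i : Fin m) (z : ℝ)
    (hz : z ∈ Ioo 0 (tank m E x + x.1 i)) : Function.update x.1 i z ∈ simU m E :=
  (upd_mem x.1 i z).2 ⟨fun j _ => x.2.1 j, hz⟩

lemma extF_upd {m : ℕ} {E : ℝ} (F : Delta m E → ENNReal) (x : Delta m E) (i : Fin m) (z : ℝ)
    (hz : z ∈ Ioo 0 (tank m E x + x.1 i)) :
    extF F (Function.update x.1 i z) = F ⟨_, upd_memD x i z hz⟩ :=
  extF_mem F ⟨_, upd_memD x i z hz⟩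

lemma meas_tank {m : ℕ} {E : ℝ} : Measurable (tank m E) := by
  unfold tank
  exact measurable_const.sub (Finset.measurable_sum _ fun i _ =>
    ((measurable_pi_apply i).comp measurable_subtype_coe))

lemma meas_dens {m : ℕ} {E : ℝ} (a : ℝ) :
    Measurable (fun x : Delta m E => ENNReal.ofReal (tank m E x ^ a)) :=
  ENNReal.measurable_ofReal.comp (meas_tank.pow_const a)

lemma tank_upd {m : ℕ} {E : ℝ} (x : Delta m E) (i : Fin m) (z : ℝ)
    (hz : z ∈ Ioo 0 (tank m E x + x.1 i)) :
    tank m E ⟨_, upd_memD x i z hz⟩ = tank m E x + x.1 i - z := by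
  simp only [tank, sum_upd]
  ring

lemma inv_i {m : ℕ} {E : ℝ} (i : Fin m) (F : Delta m E → ENNReal) (hF : Measurable F) :
    ∫⁻ x, ENNReal.ofReal (tank m E x ^ (-(1/2) : ℝ)) * (ENNReal.ofReal (Real.sqrt (x.1 i)) *
      ∫⁻ u in Ioo (0:ℝ) 1, F (Texch m E i u x)) ∂(lebU m E)
    = ∫⁻ x, ENNReal.ofReal (tank m E x ^ (-(1/2) : ℝ)) * (ENNReal.ofReal (Real.sqrt (x.1 i)) *
      F x) ∂(lebU m E) := by
  refine slice_eq i _ _ ((meas_dens _).mul ((meas_sqrt_coord i).mul (meas_jumpint i F hF)))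
    ((meas_dens _).mul ((meas_sqrt_coord i).mul hF)) fun x => ?_
  have hs : 0 < tank m E x + x.1 i := add_pos (tank_pos x) (x.2.1 i)
  have g := gibbs1D _ hs (fun z => extF F (Function.update x.1 i z))
    (meas_upd_comp _ (meas_extF F hF) x.1 i)
  refine Eq.trans ?_ (g.trans ?_)
  · refine setLIntegral_congr_fun measurableSet_Ioo fun z hz => ?_
    rw [extF_upd _ _ _ _ hz, tank_upd _ _ _ hz]
    simp only [Function.update_self]
    congr 2
    refine setLIntegral_congr_fun measurableSet_Ioo fun u hu => ?_
    rw [← extF_mem F, Texch_val i u hu]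
    simp only [T0_upd]
    rfl
  · refine setLIntegral_congr_fun measurableSet_Ioo fun z hz => ?_
    rw [extF_upd _ _ _ _ hz, extF_upd _ _ _ _ hz, tank_upd _ _ _ hz]
    simp only [Function.update_self]

lemma inv_pre {m : ℕ} (hm : 1 ≤ m) {E : ℝ} (hE : 0 < E) (F : Delta m E → ENNReal)
    (hF : Measurable F) :
    ∫⁻ x, (∫⁻ z, F z ∂(ustep m E x)) ∂(piPre m E) = ∫⁻ x, F x ∂(piPre m E) := by
  have hG : Measurable fun z => ∫⁻ w, F w ∂(ustep m E z) :=
    (Measure.measurable_lintegral hF).comp (meas_ustep m E)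
  unfold piPre
  rw [lintegral_withDensity_eq_lintegral_mul _ (meas_dens _) hG,
    lintegral_withDensity_eq_lintegral_mul _ (meas_dens _) hF]
  simp only [Pi.mul_apply]
  have key : ∀ (g : Fin m → Delta m E → ENNReal), (∀ i, Measurable (g i)) →
      ∫⁻ x, ENNReal.ofReal (tank m E x ^ (-(1/2) : ℝ)) * (
        ENNReal.ofReal (1 - jumpRate m E x / Lam m E) * F x
      + (ENNReal.ofReal (Lam m E))⁻¹ * ∑ i, ENNReal.ofReal (Real.sqrt (x.1 i)) * g i x) ∂(lebU m E)
      = ∫⁻ x, ENNReal.ofReal (tank m E x ^ (-(1/2) : ℝ)) * (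
        ENNReal.ofReal (1 - jumpRate m E x / Lam m E) * F x) ∂(lebU m E) + 
        (ENNReal.ofReal (Lam m E))⁻¹ * ∑ i, 
        ∫⁻ x, ENNReal.ofReal (tank m E x ^ (-(1/2) : ℝ)) * (ENNReal.ofReal (Real.sqrt (x.1 i)) *
          g i x) ∂(lebU m E) := by
    intro g hg
    have hm1 : ∀ i ∈ Finset.univ, Measurable fun x : Delta m E => 
      ENNReal.ofReal (tank m E x ^ (-(1/2) : ℝ)) * (ENNReal.ofReal (Real.sqrt (x.1 i)) *
          g i x) := fun i _ => (meas_dens _).mul ((meas_sqrt_coord i).mul (hg i))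
    have hm2 : Measurable fun x : Delta m E => ENNReal.ofReal (tank m E x ^ (-(1/2) : ℝ)) * (
        ENNReal.ofReal (1 - jumpRate m E x / Lam m E) * F x) :=
      (meas_dens _).mul (meas_hold.mul hF)
    rw [← lintegral_finsetSum _ hm1, ← lintegral_const_mul _ (Finset.measurable_sum _ hm1),
      ← lintegral_add_left hm2]
    refine lintegral_congr fun x => ?_
    rw [mul_add, ← Finset.mul_sum]
    ring
  simp only [lint_ustep _ F hF]
  rw [key (fun i x => ∫⁻ u in Ioo (0:ℝ) 1, F (Texch m E i u x)) fun i => meas_jumpint i F hF]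
  simp only [inv_i _ F hF]
  rw [← key (fun i x => F x) fun _ => hF]
  refine lintegral_congr fun x => ?_
  rw [← Finset.sum_mul, ← mul_assoc _ _ (F x), ← add_mul, weights hm hE, one_mul]

lemma inv_pi {m : ℕ} (hm : 1 ≤ m) {E : ℝ} (hE : 0 < E) (n : ℕ) (F : Delta m E → ENNReal)
    (hF : Measurable F) :
    ∫⁻ x, (∫⁻ z, F z ∂(ustepIter m E n x)) ∂(piMeasure m E) = ∫⁻ x, F x ∂(piMeasure m E) := by
  induction n with
  | zero => 
    refine lintegral_congr fun x => ?_
    rw [ustepIter, lintegral_dirac' _ hF]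
  | succ n ih =>
    simp only [lint_iter_succ n _ F hF]
    rw [← ih]
    unfold piMeasure
    rw [lintegral_smul_measure, lintegral_smul_measure, inv_pre hm hE _ (meas_lint_iter n F hF)]

lemma swap_mem {m : ℕ} {E : ℝ} (x : Delta m E) (i : Fin m) : tank m E x ∈ Ioo 0 (tank m E x + x.1 i) :=
  ⟨tank_pos x, by linarith [x.2.1 i]⟩

noncomputable def swapD {m : ℕ} {E : ℝ} (i : Fin m) (x : Delta m E) : Delta m E :=
  ⟨Function.update x.1 i (tank m E x), upd_memD x i _ (swap_mem x i)⟩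

lemma tank_swap {m : ℕ} {E : ℝ} (x : Delta m E) (i : Fin m) : tank m E (swapD i x) = x.1 i := by
  unfold swapD
  rw [tank_upd _ _ _ (swap_mem x i)]
  ring

lemma meas_swap {m : ℕ} {E : ℝ} (i : Fin m) : Measurable (swapD (m := m) (E := E) i) := by
  rw [← (emb_simU m E).measurable_comp_iff, measurable_pi_iff]
  intro j
  by_cases h : j = i
  · subst h
    simpa [swapD, Function.comp_def] using meas_tank
  · simpa [swapD, Function.comp_def, h] using 
      ((measurable_pi_apply j).comp measurable_subtype_coe)

lemma lint_swap {m : ℕ} {E : ℝ} (i : Fin m) (F : Delta m E → ENNReal) (hF : Measurable F) :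
    ∫⁻ x, F (swapD i x) ∂(lebU m E) = ∫⁻ x, F x ∂(lebU m E) := by
  refine slice_eq i _ _ (hF.comp (meas_swap i)) hF fun x => ?_
  have := refl_subst 0 (tank m E x + x.1 i) (tank m E x + x.1 i) 
    (fun z => extF F (Function.update x.1 i z))
  rw [sub_self, sub_zero] at this
  rw [← this]
  refine setLIntegral_congr_fun measurableSet_Ioo fun z hz => ?_
  rw [extF_upd _ _ _ _ hz]
  have hz' : tank m E x + x.1 i - z ∈ Ioo 0 (tank m E x + x.1 i) := 
    ⟨by linarith [hz.2], by linarith [hz.1]⟩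
  rw [extF_upd _ _ _ _ hz']
  congr 1
  apply Subtype.ext
  simp only [swapD, Function.update_idem]
  rw [tank_upd _ _ _ hz]

noncomputable def psi {m : ℕ} {E : ℝ} (a : ℝ) (x : Delta m E) : ℝ :=
  tank m E x ^ (-a) * ∏ k, (x.1 k) ^ (-a)

lemma psi_pos {m : ℕ} {E : ℝ} (a : ℝ) (x : Delta m E) : 0 < psi a x :=
  mul_pos (Real.rpow_pos_of_pos (tank_pos x) _)
    (Finset.prod_pos fun k _ => Real.rpow_pos_of_pos (x.2.1 k) _)

lemma psi_swap {m : ℕ} {E : ℝ} (a : ℝ) (i : Fin m) (x : Delta m E) : psi a (swapD i x) = psi a x := by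
  unfold psi
  rw [tank_swap, ← Finset.mul_prod_erase Finset.univ _ (Finset.mem_univ i),
    ← Finset.mul_prod_erase Finset.univ (fun k => x.1 k ^ (-a)) (Finset.mem_univ i)]
  have : ∏ k ∈ Finset.univ.erase i, (swapD i x).1 k ^ (-a) = ∏ k ∈ Finset.univ.erase i, x.1 k ^ (-a) := by
    refine Finset.prod_congr rfl fun k hk => ?_
    simp [swapD, Finset.ne_of_mem_erase hk]
  rw [this]
  simp only [swapD, Function.update_self]
  ring

lemma meas_coord {m : ℕ} {E : ℝ} (i : Fin m) : Measurable fun x : Delta m E => x.1 i :=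
  (measurable_pi_apply i).comp measurable_subtype_coe

lemma meas_psi {m : ℕ} {E : ℝ} (a : ℝ) : Measurable (psi (m := m) (E := E) a) := by
  unfold psi
  exact (meas_tank.pow_const _).mul (Finset.measurable_prod _ fun i _ => (meas_coord i).pow_const _)

lemma coord_lt {m : ℕ} {E : ℝ} (x : Delta m E) (i : Fin m) : x.1 i < E := by
  have := Finset.single_le_sum (f := x.1) (fun j _ => (x.2.1 j).le) (Finset.mem_univ i)
  linarith [x.2.2]

lemma tank_le {m : ℕ} {E : ℝ} (x : Delta m E) : tank m E x ≤ E := by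
  have := Finset.sum_nonneg (s := Finset.univ) (f := x.1) (fun j _ => (x.2.1 j).le)
  unfold tank
  linarith

lemma psi_fin {m : ℕ} {E : ℝ} (hE : 0 < E) (a : ℝ) (ha0 : 0 ≤ a) (ha : a < 1) :
    ∫⁻ x, ENNReal.ofReal (psi a x) ∂(lebU m E) < ⊤ := by
  set c : ℝ := E / (m + 1) with hc
  have hc0 : 0 < c := by positivity
  set G : Delta m E → ENNReal := {x | c ≤ tank m E x}.indicator (fun x => ENNReal.ofReal (psi a x))
    with hGdef
  have hG : Measurable G := (ENNReal.measurable_ofReal.comp (meas_psi a)).indicator 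
    (measurableSet_le measurable_const meas_tank)
  have h1 : ∀ x, ENNReal.ofReal (psi a x) ≤ G x + ∑ i, G (swapD i x) := by
    intro x
    by_cases h : c ≤ tank m E x
    · have : G x = ENNReal.ofReal (psi a x) := indicator_of_mem (s := {x | c ≤ tank m E x}) h _
      rw [this]; exact le_self_add
    · obtain ⟨i, hi⟩ : ∃ i, c ≤ x.1 i := by
        by_contra hcon
        push Not at hcon h
        have h3 : ∑ i, x.1 i ≤ m * c := by
          have := Finset.sum_le_card_nsmul Finset.univ x.1 c fun i _ => (hcon i).le
          simpa using this
        have h4 : (m + 1) * c = E := by rw [hc]; field_simp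
        unfold tank at h
        linarith
      have : G (swapD i x) = ENNReal.ofReal (psi a x) := by
        rw [hGdef, indicator_of_mem, psi_swap]
        rw [mem_ofPred_eq, tank_swap]; exact hi
      rw [← this]
      exact (Finset.single_le_sum (f := fun i => G (swapD i x)) (fun _ _ => zero_le)
        (Finset.mem_univ i)).trans le_add_self
  have h2 : ∫⁻ x, G x ∂(lebU m E) < ⊤ := by
    set g : ℝ → ℝ := (Ioo 0 E).indicator (fun z => z ^ (-a)) with hg
    have hgi : Integrable g := by
      rw [hg, integrable_indicator_iff measurableSet_Ioo, 
        intervalIntegral.integrableOn_Ioo_rpow_iff hE]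
      linarith
    have hP := Integrable.fintype_prod (ι := Fin m) (f := fun _ => g) (μ := fun _ => volume) 
      (fun _ => hgi)
    have := (hP.const_mul (c ^ (-a))).lintegral_lt_top
    refine lt_of_le_of_lt ?_ this
    rw [lint_lebU, volume_pi]
    refine lintegral_mono fun x => ?_
    by_cases hx : x ∈ simU m E
    · have h0 := extF_mem G ⟨x, hx⟩
      simp only [] at h0
      rw [h0]
      by_cases h : c ≤ tank m E ⟨x, hx⟩
      · rw [hGdef, indicator_of_mem (s := {x | c ≤ tank m E x}) h]
        refine ENNReal.ofReal_le_ofReal ?_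
        unfold psi
        refine mul_le_mul (Real.rpow_le_rpow_of_nonpos hc0 h (by linarith)) ?_ 
          (Finset.prod_nonneg fun k _ => (Real.rpow_pos_of_pos (hx.1 k) _).le) (by positivity)
        refine (Finset.prod_congr rfl fun k _ => ?_).le
        rw [hg, indicator_of_mem]
        exact ⟨hx.1 k, coord_lt ⟨x, hx⟩ k⟩
      · rw [hGdef, indicator_of_notMem (s := {x | c ≤ tank m E x}) h]
        exact zero_le
    · rw [extF_not_mem _ _ hx]
      exact zero_le
  have hGs : ∀ i ∈ Finset.univ, Measurable fun x => G (swapD i x) := fun i _ => hG.comp (meas_swap i)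
  refine (lintegral_mono h1).trans_lt ?_
  rw [lintegral_add_left hG, lintegral_finsetSum _ hGs]
  simp only [lint_swap _ G hG]
  rw [ENNReal.add_lt_top, ENNReal.sum_lt_top]
  exact ⟨h2, fun _ _ => h2⟩

lemma piPre_fin {m : ℕ} {E : ℝ} (hE : 0 < E) (a : ℝ) (ha0 : 0 ≤ a) (ha : a < 1)
    (f : Delta m E → ℝ) (hf : Measurable f) (K : ℝ)
    (h : ∀ x, tank m E x ^ (-(1/2) : ℝ) * f x ≤ K * psi a x) :
    ∫⁻ x, ENNReal.ofReal (f x) ∂(piPre m E) < ⊤ := by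
  have hf2 : Measurable fun x => ENNReal.ofReal (f x) := ENNReal.measurable_ofReal.comp hf
  unfold piPre
  rw [lintegral_withDensity_eq_lintegral_mul _ (meas_dens _) hf2]
  have : ∫⁻ x, ENNReal.ofReal K * ENNReal.ofReal (psi a x) ∂(lebU m E) < ⊤ := by
    have hf3 : Measurable fun x : Delta m E => ENNReal.ofReal (psi a x) := ENNReal.measurable_ofReal.comp (meas_psi a)
    rw [lintegral_const_mul _ hf3]
    exact ENNReal.mul_lt_top ENNReal.ofReal_lt_top (psi_fin hE a ha0 ha)
  refine (lintegral_mono fun x => ?_).trans_lt this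
  simp only [Pi.mul_apply]
  rw [← ENNReal.ofReal_mul (Real.rpow_nonneg (tank_pos x).le _),
    ← ENNReal.ofReal_mul' (psi_pos a x).le]
  exact ENNReal.ofReal_le_ofReal (h x)

/-- comparison of powers on (0,E] -/
lemma pow_cmp {E t a b : ℝ} (ht : 0 < t) (htE : t ≤ E) (hab : b ≤ a) :
    t ^ (-b) ≤ E ^ (a - b) * t ^ (-a) := by
  have : t ^ (-b) = t ^ (a - b) * t ^ (-a) := by
    rw [← Real.rpow_add ht]; congr 1; ring
  rw [this]
  exact mul_le_mul_of_nonneg_right (Real.rpow_le_rpow ht.le htE (by linarith)) 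
    (Real.rpow_nonneg ht.le _)

lemma psi_lower {m : ℕ} {E : ℝ} (hE : 0 < E) (a : ℝ) (ha0 : 0 ≤ a) :
    ∃ K : ℝ, 0 ≤ K ∧ ∀ x : Delta m E, (1 ≤ K * ∏ k, x.1 k ^ (-a)) ∧ 
      ∀ i, x.1 i ^ (-a) ≤ K * ∏ k, x.1 k ^ (-a) := by
  set q : ℝ := max 1 (E ^ a) with hq
  have hq1 : 1 ≤ q := le_max_left _ _
  have hfac : ∀ x : Delta m E, ∀ k, 1 ≤ q * x.1 k ^ (-a) := by
    intro x k
    have := pow_cmp (E := E) (a := a) (b := 0) (x.2.1 k) (coord_lt x k).le ha0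
    rw [neg_zero, Real.rpow_zero, sub_zero] at this
    refine this.trans (mul_le_mul_of_nonneg_right (le_max_right _ _) 
      (Real.rpow_nonneg (x.2.1 k).le _))
  refine ⟨q ^ m, by positivity, fun x => ?_⟩
  have e : q ^ m * ∏ k, x.1 k ^ (-a) = ∏ k, (q * x.1 k ^ (-a)) := by
    rw [Finset.prod_mul_distrib]; simp
  rw [e]
  refine ⟨Finset.one_le_prod (R := ℝ) fun k _ => hfac x k, fun i => ?_⟩
  rw [← Finset.mul_prod_erase Finset.univ _ (Finset.mem_univ i)]
  have h1 : 1 ≤ ∏ k ∈ Finset.univ.erase i, (q * x.1 k ^ (-a)) := 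
    Finset.one_le_prod (R := ℝ) fun k _ => hfac x k
  have h0 := Real.rpow_nonneg (x.2.1 i).le (-a)
  have h2 : x.1 i ^ (-a) ≤ q * x.1 i ^ (-a) := by nlinarith
  nlinarith

noncomputable def vD {m : ℕ} {E : ℝ} (a A : ℝ) (x : Delta m E) : ℝ :=
  ∑ i, x.1 i ^ (-a) + A * tank m E x ^ (-(a - 1/2))

lemma meas_vD {m : ℕ} {E : ℝ} (a A : ℝ) : Measurable (vD (m := m) (E := E) a A) := by
  unfold vD
  exact (Finset.measurable_sum _ fun i _ => (meas_coord i).pow_const _).add 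
    ((meas_tank.pow_const _).const_mul _)

lemma vD_fin {m : ℕ} {E : ℝ} (hE : 0 < E) (a A : ℝ) (ha0 : 1/2 ≤ a) (ha : a < 1) (hA : 0 ≤ A) :
    ∫⁻ x, ENNReal.ofReal (vD a A x) ∂(piPre m E) < ⊤ := by
  obtain ⟨K, hK0, hK⟩ := psi_lower (m := m) hE a (by linarith)
  refine piPre_fin hE a (by linarith) ha _ (meas_vD a A) (m * E ^ (a - 1/2) * K + A * K) fun x => ?_
  have ht := tank_pos x
  have hy := pow_cmp (b := 1/2) ht (tank_le x) ha0
  set P := ∏ k, x.1 k ^ (-a) with hP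
  have hsum : ∑ i, x.1 i ^ (-a) ≤ m * (K * P) := by
    have := Finset.sum_le_card_nsmul Finset.univ (fun i => x.1 i ^ (-a)) (K * P) fun i _ => (hK x).2 i
    simpa using this
  have hs0 : 0 ≤ ∑ i, x.1 i ^ (-a) := Finset.sum_nonneg fun i _ => Real.rpow_nonneg (x.2.1 i).le _
  have e : tank m E x ^ (-(1/2) : ℝ) * tank m E x ^ (-(a - 1/2)) = tank m E x ^ (-a) := by
    rw [← Real.rpow_add ht]; congr 1; ring
  have h0 := Real.rpow_nonneg ht.le (-a)
  have hE0 := Real.rpow_nonneg hE.le (a - 1/2)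
  unfold vD psi
  rw [mul_add, mul_left_comm, e, ← hP, add_mul]
  refine add_le_add ?_ ?_
  · calc _ ≤ (E ^ (a - 1/2) * tank m E x ^ (-a)) * (m * (K * P)) := 
        mul_le_mul hy hsum hs0 (by positivity)
      _ = _ := by ring
  · have := mul_le_mul_of_nonneg_left (hK x).1 (mul_nonneg hA h0)
    linarith

lemma Z_fin {m : ℕ} {E : ℝ} (hE : 0 < E) : piPre m E univ < ⊤ := by
  obtain ⟨K, hK0, hK⟩ := psi_lower (m := m) hE (1/2) (by norm_num)
  have := piPre_fin (m := m) hE (1/2) (by norm_num) (by norm_num) (fun _ => 1) measurable_const K 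
    fun x => by
      unfold psi
      have := mul_le_mul_of_nonneg_left (hK x).1 (Real.rpow_nonneg (tank_pos x).le (-(1/2)))
      linarith
  simpa using this

lemma Z_pos {m : ℕ} {E : ℝ} (hE : 0 < E) : piPre m E univ ≠ 0 := by
  have hvol : lebU m E univ ≠ 0 := by
    unfold lebU
    rw [(emb_simU m E).comap_apply, image_univ, Subtype.range_coe]
    have ho : IsOpen (simU m E) := by
      unfold simU
      rw [ofPred_and, ofPred_forall]
      exact (isOpen_iInter_of_finite fun i => isOpen_lt continuous_const (continuous_apply i)).inter
        (isOpen_lt (continuous_finsetSum _ fun i _ => continuous_apply i) continuous_const)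
    refine (ho.measure_pos _ ⟨fun _ => E / (m + 1), fun i => by positivity, ?_⟩).ne'
    simp only [Finset.sum_const, Finset.card_univ, Fintype.card_fin, nsmul_eq_mul]
    rw [mul_div_assoc', div_lt_iff₀ (by positivity)]
    nlinarith
  intro h
  unfold piPre at h
  rw [withDensity_apply _ MeasurableSet.univ, Measure.restrict_univ, 
    lintegral_eq_zero_iff (meas_dens _)] at h
  apply hvol
  have : ∀ᵐ x ∂(lebU m E), False := by
    filter_upwards [h] with x hx
    simp only [Pi.zero_apply, ENNReal.ofReal_eq_zero] at hx
    exact absurd hx (not_le.2 (Real.rpow_pos_of_pos (tank_pos x) _))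
  simpa [ae_iff] using this

lemma prob_pi {m : ℕ} {E : ℝ} (hE : 0 < E) : IsProbabilityMeasure (piMeasure m E) := by
  constructor
  unfold piMeasure
  rw [Measure.smul_apply, smul_eq_mul, ENNReal.inv_mul_cancel (Z_pos hE) (Z_fin hE).ne]

lemma int_vD {m : ℕ} {E : ℝ} (hE : 0 < E) (a A : ℝ) (ha0 : 1/2 ≤ a) (ha : a < 1) (hA : 0 ≤ A) :
    Integrable (vD a A) (piMeasure m E) := by
  have hn : ∀ x : Delta m E, 0 ≤ vD a A x := fun x => 
    add_nonneg (Finset.sum_nonneg fun i _ => Real.rpow_nonneg (x.2.1 i).le _) 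
      (mul_nonneg hA (Real.rpow_nonneg (tank_pos x).le _))
  refine ⟨(meas_vD a A).aestronglyMeasurable, ?_⟩
  rw [hasFiniteIntegral_iff_ofReal (Eventually.of_forall hn)]
  unfold piMeasure
  rw [lintegral_smul_measure]
  exact ENNReal.mul_lt_top (ENNReal.inv_lt_top.2 (pos_iff_ne_zero.2 (Z_pos hE))) 
    (vD_fin hE a A ha0 ha hA)

lemma bd_int (c0 c1 c2 d : ℝ) (h0 : 0 ≤ c0) (h1 : 0 ≤ c1) (h2 : 0 ≤ c2) (hd : d < 1/2) :
    ∫⁻ u in Ioo (0:ℝ) 1, ENNReal.ofReal (c0 + c1 * (1 - u) ^ (-(1/2) : ℝ) + c2 * u ^ (-(2 * d)))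
      = ENNReal.ofReal (c0 + 2 * c1 + c2 * (1 / (1 - 2 * d))) := by
  have i1 : IntervalIntegrable (fun u : ℝ => u ^ (-(1/2) : ℝ)) volume 0 1 := 
    intervalIntegral.intervalIntegrable_rpow' (by norm_num)
  have i1' : IntervalIntegrable (fun u : ℝ => (1 - u) ^ (-(1/2) : ℝ)) volume 0 1 := by
    have := (i1.comp_sub_left 1).symm
    simpa using this
  have i2 : IntervalIntegrable (fun u : ℝ => u ^ (-(2 * d))) volume 0 1 := 
    intervalIntegral.intervalIntegrable_rpow' (by linarith)
  have i0 : IntervalIntegrable (fun _ : ℝ => c0) volume 0 1 := intervalIntegrable_const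
  have hv : ∫ u in (0:ℝ)..1, (c0 + c1 * (1 - u) ^ (-(1/2) : ℝ) + c2 * u ^ (-(2 * d)))
      = c0 + 2 * c1 + c2 * (1 / (1 - 2 * d)) := by
    rw [intervalIntegral.integral_add (i0.add (i1'.const_mul c1)) (i2.const_mul c2), 
      intervalIntegral.integral_add i0 (i1'.const_mul c1), intervalIntegral.integral_const_mul,
      intervalIntegral.integral_const_mul, 
      intervalIntegral.integral_comp_sub_left (fun u : ℝ => u ^ (-(1/2) : ℝ)), 
      integral_rpow (Or.inl (by norm_num)), integral_rpow (Or.inl (by linarith)),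
      intervalIntegral.integral_const]
    rw [Real.zero_rpow (show -(2 * d) + 1 ≠ 0 by linarith), sub_self, sub_zero, Real.one_rpow, 
      Real.one_rpow, Real.zero_rpow (by norm_num)]
    simp only [smul_eq_mul]
    rw [show -(2 * d) + 1 = 1 - 2 * d by ring]
    norm_num
    ring
  have ii := (i0.add (i1'.const_mul c1)).add (i2.const_mul c2)
  rw [intervalIntegrable_iff_integrableOn_Ioo_of_le zero_le_one] at ii
  rw [← hv, intervalIntegral.integral_of_le zero_le_one, integral_Ioc_eq_integral_Ioo,
    ofReal_integral_eq_lintegral_ofReal ii]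
  refine (ae_restrict_iff' measurableSet_Ioo).2 (Eventually.of_forall fun u hu => ?_)
  have := Real.rpow_nonneg hu.1.le (-(2 * d))
  have := Real.rpow_nonneg (sub_nonneg.2 hu.2.le) (-(1/2) : ℝ)
  simp only [Pi.zero_apply]
  positivity

lemma w_bd {x y u a : ℝ} (hx : 0 < x) (hy : 0 < y) (hu : u ∈ Ioo (0:ℝ) 1) (ha : 1/2 ≤ a) :
    (y + (1 - u ^ 2) * x) ^ (-a) ≤ (y ^ (-(a - 1/2)) * x ^ (-(1/2) : ℝ)) * (1 - u) ^ (-(1/2) : ℝ) := by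
  have h1 : 0 < 1 - u := by linarith [hu.2]
  have h2 : 1 - u ≤ 1 - u ^ 2 := by nlinarith [hu.1]
  have h3 : (1 - u) * x ≤ (1 - u ^ 2) * x := mul_le_mul_of_nonneg_right h2 hx.le
  have h4 : 0 < (1 - u) * x := by positivity
  have hw : 0 < y + (1 - u ^ 2) * x := by linarith
  rw [show -a = -(a - 1/2) + (-(1/2)) by ring, Real.rpow_add hw, mul_assoc, 
    mul_comm (x ^ (-(1/2) : ℝ)), ← Real.mul_rpow h1.le hx.le]
  exact mul_le_mul (Real.rpow_le_rpow_of_nonpos hy (by linarith) (by linarith)) 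
    (Real.rpow_le_rpow_of_nonpos h4 (by linarith) (by norm_num)) 
    (Real.rpow_nonneg hw.le _) (Real.rpow_nonneg hy.le _)

lemma tank_Texch {m : ℕ} {E : ℝ} (i : Fin m) (u : ℝ) (hu : u ∈ Ioo (0:ℝ) 1) (x : Delta m E) :
    tank m E (Texch m E i u x) = u ^ 2 * x.1 i := by
  unfold tank
  rw [Texch_val i u hu, T0, sum_upd]
  ring

lemma jump_bd {m : ℕ} {E : ℝ} (a A : ℝ) (ha : 1/2 ≤ a) (ha1 : a < 1) (hA : 0 ≤ A) (i : Fin m) 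
    (x : Delta m E) :
    ∫⁻ u in Ioo (0:ℝ) 1, ENNReal.ofReal (vD a A (Texch m E i u x)) ≤
      ENNReal.ofReal ((∑ k, x.1 k ^ (-a) - x.1 i ^ (-a)) + 
        2 * (tank m E x ^ (-(a - 1/2)) * x.1 i ^ (-(1/2) : ℝ)) + 
        (A * x.1 i ^ (-(a - 1/2))) * (1 / (1 - 2 * (a - 1/2)))) := by
  have hx := x.2.1 i
  have hy := tank_pos x
  have hS : ∑ k, x.1 k ^ (-a) - x.1 i ^ (-a) = ∑ k ∈ Finset.univ.erase i, x.1 k ^ (-a) := by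
    rw [← Finset.add_sum_erase Finset.univ _ (Finset.mem_univ i)]; ring
  have hS0 : 0 ≤ ∑ k, x.1 k ^ (-a) - x.1 i ^ (-a) := by
    rw [hS]; exact Finset.sum_nonneg fun k _ => Real.rpow_nonneg (x.2.1 k).le _
  rw [← bd_int _ _ _ _ hS0 (mul_nonneg (Real.rpow_nonneg hy.le _) (Real.rpow_nonneg hx.le _))
    (mul_nonneg hA (Real.rpow_nonneg hx.le _)) (by linarith)]
  refine setLIntegral_mono' measurableSet_Ioo fun u hu => ENNReal.ofReal_le_ofReal ?_
  unfold vD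
  rw [tank_Texch i u hu, Texch_val i u hu, ← Finset.add_sum_erase Finset.univ _ (Finset.mem_univ i), hS]
  have e1 : ∑ k ∈ Finset.univ.erase i, T0 m E i u x.1 k ^ (-a) = 
      ∑ k ∈ Finset.univ.erase i, x.1 k ^ (-a) := by
    refine Finset.sum_congr rfl fun k hk => ?_
    simp [T0, Finset.ne_of_mem_erase hk]
  have e2 : T0 m E i u x.1 i = tank m E x + (1 - u ^ 2) * x.1 i := by
    simp [T0, tank]
  have e3 : (u ^ 2 * x.1 i) ^ (-(a - 1/2)) = u ^ (-(2 * (a - 1/2))) * x.1 i ^ (-(a - 1/2)) := by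
    rw [Real.mul_rpow (by positivity) hx.le, ← Real.rpow_natCast, ← Real.rpow_mul hu.1.le]
    congr 2
    push_cast; ring
  rw [e1, e2, e3]
  have := w_bd hx hy hu ha
  linarith

noncomputable def PsiD {m : ℕ} {E : ℝ} (a : ℝ) (x : Delta m E) : ℝ :=
  ∑ i, x.1 i ^ (-(a - 1/2)) + tank m E x ^ (-(a - 1/2))

lemma rate_lower {m : ℕ} {E : ℝ} (x : Delta m E) : Real.sqrt (E - tank m E x) ≤ jumpRate m E x := by
  unfold jumpRate tank
  rw [sub_sub_cancel]
  refine Real.sqrt_le_iff.2 ⟨Finset.sum_nonneg fun i _ => Real.sqrt_nonneg _, ?_⟩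
  have h := Finset.sum_sq_le_sq_sum_of_nonneg (s := Finset.univ) (f := fun i => Real.sqrt (x.1 i))
    fun i _ => Real.sqrt_nonneg _
  refine le_trans (le_of_eq ?_) h
  exact Finset.sum_congr rfl fun i _ => (Real.sq_sqrt (x.2.1 i).le).symm

lemma drift_real {m : ℕ} {E : ℝ} (hE : 0 < E) (a : ℝ) (ha : 1/2 < a) (ha1 : a < 1) :
    ∃ A b : ℝ, 0 < A ∧ 0 < b ∧ ∀ x : Delta m E, 
      ∑ i, Real.sqrt (x.1 i) * (((∑ k, x.1 k ^ (-a) - x.1 i ^ (-a)) + 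
        2 * (tank m E x ^ (-(a - 1/2)) * x.1 i ^ (-(1/2) : ℝ)) + 
        (A * x.1 i ^ (-(a - 1/2))) * (1 / (1 - 2 * (a - 1/2)))) - vD a A x) + PsiD a x ≤ b := by
  set δ := a - 1/2 with hδ
  set A : ℝ := (2 * m + 1) / Real.sqrt (E / 2) with hA
  set D : ℝ := 1 / (1 - 2 * δ) with hD
  have hD0 : 0 < D := by rw [hD]; apply one_div_pos.2; linarith
  have hs : 0 < Real.sqrt (E / 2) := Real.sqrt_pos.2 (by linarith)
  have hA0 : 0 < A := by rw [hA]; positivity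
  refine ⟨A, (2 * m + 1) * (E/2) ^ (-δ) + A * D * (m * E ^ (1/2 - δ)), hA0, ?_, fun x => ?_⟩
  · have : 0 < (E/2) ^ (-δ) := Real.rpow_pos_of_pos (by linarith) _
    positivity
  have hy := tank_pos x
  set Y := tank m E x ^ (-δ) with hY
  have hY0 : 0 < Y := Real.rpow_pos_of_pos hy _
  have e : ∀ i, Real.sqrt (x.1 i) * (((∑ k, x.1 k ^ (-a) - x.1 i ^ (-a)) + 
        2 * (Y * x.1 i ^ (-(1/2) : ℝ)) + 
        (A * x.1 i ^ (-δ)) * D) - vD a A x) = 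
      - x.1 i ^ (-δ) - A * Y * Real.sqrt (x.1 i) + 2 * Y + A * D * x.1 i ^ (1/2 - δ) := by
    intro i
    have hx := x.2.1 i
    unfold vD
    rw [← hδ, ← hY]
    have e1 : Real.sqrt (x.1 i) * x.1 i ^ (-a) = x.1 i ^ (-δ) := by
      rw [Real.sqrt_eq_rpow, ← Real.rpow_add hx]; congr 1; rw [hδ]; ring
    have e2 : Real.sqrt (x.1 i) * x.1 i ^ (-(1/2) : ℝ) = 1 := by
      rw [Real.sqrt_eq_rpow, ← Real.rpow_add hx]; norm_num
    have e3 : Real.sqrt (x.1 i) * x.1 i ^ (-δ) = x.1 i ^ (1/2 - δ) := by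
      rw [Real.sqrt_eq_rpow, ← Real.rpow_add hx]; congr 1
    linear_combination (-1) * e1 + 2 * Y * e2 + A * D * e3
  simp only [e]
  unfold PsiD
  rw [← hδ, ← hY, Finset.sum_add_distrib, Finset.sum_add_distrib, Finset.sum_sub_distrib, 
    ← Finset.mul_sum, ← Finset.mul_sum (s := Finset.univ) (a := A * D), Finset.sum_neg_distrib]
  have hr := rate_lower x
  unfold jumpRate at hr
  have h5 : ∑ i, x.1 i ^ (1/2 - δ) ≤ m * E ^ (1/2 - δ) := by
    have := Finset.sum_le_card_nsmul Finset.univ (fun i => x.1 i ^ (1/2 - δ)) (E ^ (1/2 - δ)) 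
      fun i _ => Real.rpow_le_rpow (x.2.1 i).le (coord_lt x i).le (by linarith)
    simpa using this
  have h6 := mul_le_mul_of_nonneg_left h5 (mul_nonneg hA0.le hD0.le)
  have h7 : (2 * m + 1 - A * ∑ i, Real.sqrt (x.1 i)) * Y ≤ (2 * m + 1) * (E/2) ^ (-δ) := by
    have hE2 : 0 < (E/2) ^ (-δ) := Real.rpow_pos_of_pos (by linarith) _
    by_cases h : tank m E x ≤ E / 2
    · have : Real.sqrt (E / 2) ≤ ∑ i, Real.sqrt (x.1 i) := 
        (Real.sqrt_le_sqrt (by linarith)).trans hr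
      have h8 : (2 * m + 1 : ℝ) ≤ A * ∑ i, Real.sqrt (x.1 i) := by
        rw [hA, div_mul_eq_mul_div, le_div_iff₀ hs]
        exact mul_le_mul_of_nonneg_left this (by positivity)
      have : (2 * m + 1 - A * ∑ i, Real.sqrt (x.1 i)) * Y ≤ 0 := 
        mul_nonpos_of_nonpos_of_nonneg (by linarith) hY0.le
      exact this.trans (by positivity)
    · push Not at h
      have h9 : Y ≤ (E/2) ^ (-δ) := Real.rpow_le_rpow_of_nonpos (by linarith) h.le (by linarith)
      have h10 : 0 ≤ A * ∑ i, Real.sqrt (x.1 i) := 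
        mul_nonneg hA0.le (Finset.sum_nonneg fun i _ => Real.sqrt_nonneg _)
      have h11 : (2 * m + 1 : ℝ) * Y ≤ (2 * m + 1) * (E/2) ^ (-δ) := 
        mul_le_mul_of_nonneg_left h9 (by positivity)
      nlinarith
  simp only [Finset.sum_const, Finset.card_univ, Fintype.card_fin, nsmul_eq_mul]
  linarith

lemma vD_nonneg {m : ℕ} {E : ℝ} (a A : ℝ) (hA : 0 ≤ A) (x : Delta m E) : 0 ≤ vD a A x := 
    add_nonneg (Finset.sum_nonneg fun i _ => Real.rpow_nonneg (x.2.1 i).le _) 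
      (mul_nonneg hA (Real.rpow_nonneg (tank_pos x).le _))

lemma PsiD_nonneg {m : ℕ} {E : ℝ} (a : ℝ) (x : Delta m E) : 0 ≤ PsiD a x := 
    add_nonneg (Finset.sum_nonneg fun i _ => Real.rpow_nonneg (x.2.1 i).le _) 
      ((Real.rpow_nonneg (tank_pos x).le _))

lemma drift_one {m : ℕ} (hm : 1 ≤ m) {E : ℝ} (hE : 0 < E) (a : ℝ) (ha : 1/2 < a) (ha1 : a < 1) :
    ∃ A b : ℝ, 0 < A ∧ 0 < b ∧ ∀ x : Delta m E, 
      ∫⁻ z, ENNReal.ofReal (vD a A z) ∂(ustep m E x) + ENNReal.ofReal (PsiD a x / Lam m E) ≤ 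
        ENNReal.ofReal (vD a A x) + ENNReal.ofReal b := by
  obtain ⟨A, b, hA, hb, h⟩ := drift_real (m := m) hE a ha ha1
  have hL := Lam_pos hm hE
  refine ⟨A, b / Lam m E, hA, by positivity, fun x => ?_⟩
  have hmv : Measurable fun z : Delta m E => ENNReal.ofReal (vD a A z) :=
    ENNReal.measurable_ofReal.comp (meas_vD a A)
  rw [lint_ustep x _ hmv]
  set R : Fin m → ℝ := fun i => ((∑ k, x.1 k ^ (-a) - x.1 i ^ (-a)) + 
        2 * (tank m E x ^ (-(a - 1/2)) * x.1 i ^ (-(1/2) : ℝ)) + 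
        (A * x.1 i ^ (-(a - 1/2))) * (1 / (1 - 2 * (a - 1/2)))) with hR
  have hR0 : ∀ i, 0 ≤ R i := by
    intro i
    have hx := x.2.1 i
    have hS := Finset.single_le_sum (f := fun k => x.1 k ^ (-a)) 
      (fun k _ => Real.rpow_nonneg (x.2.1 k).le _) (Finset.mem_univ i)
    have h1 := mul_nonneg (Real.rpow_nonneg (tank_pos x).le (-(a - 1/2))) 
      (Real.rpow_nonneg hx.le (-(1/2)))
    have h2 : 0 ≤ 1 / (1 - 2 * (a - 1/2)) := one_div_nonneg.2 (by linarith)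
    have h3 := mul_nonneg (mul_nonneg hA.le (Real.rpow_nonneg hx.le (-(a - 1/2)))) h2
    simp only [hR]
    linarith
  have hsum : ∑ i, ENNReal.ofReal (Real.sqrt (x.1 i)) *
        ∫⁻ u in Ioo (0:ℝ) 1, ENNReal.ofReal (vD a A (Texch m E i u x)) ≤ 
        ENNReal.ofReal (∑ i, Real.sqrt (x.1 i) * R i) := by
    rw [ENNReal.ofReal_sum_of_nonneg fun i _ => mul_nonneg (Real.sqrt_nonneg _) (hR0 i)]
    refine Finset.sum_le_sum fun i _ => ?_
    rw [ENNReal.ofReal_mul (Real.sqrt_nonneg _)]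
    gcongr
    exact jump_bd a A ha.le ha1 hA.le i x
  have hv0 := vD_nonneg a A hA.le x
  have hsr : 0 ≤ ∑ i, Real.sqrt (x.1 i) * R i := 
    Finset.sum_nonneg fun i _ => mul_nonneg (Real.sqrt_nonneg _) (hR0 i)
  have hr0 : 0 ≤ 1 - jumpRate m E x / Lam m E := by
    rw [sub_nonneg, div_le_one hL]; exact rate_le x
  have hP := PsiD_nonneg a x
  calc _ ≤ ENNReal.ofReal (1 - jumpRate m E x / Lam m E) * ENNReal.ofReal (vD a A x)
      + (ENNReal.ofReal (Lam m E))⁻¹ * ENNReal.ofReal (∑ i, Real.sqrt (x.1 i) * R i) + 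
      ENNReal.ofReal (PsiD a x / Lam m E) := by gcongr
    _ = ENNReal.ofReal ((1 - jumpRate m E x / Lam m E) * vD a A x + 
        (Lam m E)⁻¹ * (∑ i, Real.sqrt (x.1 i) * R i) + PsiD a x / Lam m E) := by
      rw [← ENNReal.ofReal_inv_of_pos hL, ← ENNReal.ofReal_mul hr0, 
        ← ENNReal.ofReal_mul (by positivity), ← ENNReal.ofReal_add (by positivity) (by positivity),
        ← ENNReal.ofReal_add (by positivity) (by positivity)]
    _ ≤ ENNReal.ofReal (vD a A x + b / Lam m E) := by
      refine ENNReal.ofReal_le_ofReal ?_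
      have h1 := h x
      have h2 : ∑ i, Real.sqrt (x.1 i) * (R i - vD a A x) = 
          ∑ i, Real.sqrt (x.1 i) * R i - jumpRate m E x * vD a A x := by
        unfold jumpRate
        rw [Finset.sum_mul, ← Finset.sum_sub_distrib]
        exact Finset.sum_congr rfl fun i _ => by ring
      rw [h2] at h1
      have h3 := div_le_div_of_nonneg_right h1 hL.le
      have h4 : (1 - jumpRate m E x / Lam m E) * vD a A x + 
        (Lam m E)⁻¹ * (∑ i, Real.sqrt (x.1 i) * R i) + PsiD a x / Lam m E = vD a A x + 
          (∑ i, Real.sqrt (x.1 i) * R i - jumpRate m E x * vD a A x + PsiD a x) / Lam m E := by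
        field_simp
        ring
      linarith
    _ = _ := ENNReal.ofReal_add hv0 (by positivity)

lemma drift_iter {m : ℕ} (hm : 1 ≤ m) {E : ℝ} (hE : 0 < E) (a A b : ℝ) (hA : 0 < A) (hb : 0 < b)
    (h : ∀ x : Delta m E, 
      ∫⁻ z, ENNReal.ofReal (vD a A z) ∂(ustep m E x) + ENNReal.ofReal (PsiD a x / Lam m E) ≤ 
        ENNReal.ofReal (vD a A x) + ENNReal.ofReal b) (n : ℕ) (hn : 1 ≤ n) (x : Delta m E) :
    Integrable (vD a A) (ustepIter m E n x) ∧ 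
      ∫ z, vD a A z ∂(ustepIter m E n x) + PsiD a x / Lam m E ≤ vD a A x + n * b := by
  have hL := Lam_pos hm hE
  have hmv : Measurable fun z : Delta m E => ENNReal.ofReal (vD a A z) :=
    ENNReal.measurable_ofReal.comp (meas_vD a A)
  have key0 : ∀ n (x : Delta m E), ∫⁻ z, ENNReal.ofReal (vD a A z) ∂(ustepIter m E n x) ≤ 
      ENNReal.ofReal (vD a A x) + ENNReal.ofReal (n * b) := by
    intro n
    induction n with
    | zero => intro x; rw [ustepIter, lintegral_dirac' _ hmv]; exact le_self_add
    | succ n ih =>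
      intro x
      rw [lint_iter_succ n x _ hmv]
      have := prob_ustep hm hE x
      calc _ ≤ ∫⁻ z, (ENNReal.ofReal (vD a A z) + ENNReal.ofReal (n * b)) ∂(ustep m E x) := 
            lintegral_mono ih
        _ = ∫⁻ z, ENNReal.ofReal (vD a A z) ∂(ustep m E x) + ENNReal.ofReal (n * b) := by
          rw [lintegral_add_left hmv, lintegral_const, measure_univ, mul_one]
        _ ≤ ENNReal.ofReal (vD a A x) + ENNReal.ofReal b + ENNReal.ofReal (n * b) := by
          gcongr
          exact le_self_add.trans (h x)
        _ = _ := by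
          rw [add_assoc, ← ENNReal.ofReal_add hb.le (by positivity)]
          congr 2; push_cast; ring
  have key : ∫⁻ z, ENNReal.ofReal (vD a A z) ∂(ustepIter m E n x) + 
      ENNReal.ofReal (PsiD a x / Lam m E) ≤ 
      ENNReal.ofReal (vD a A x) + ENNReal.ofReal (n * b) := by
    obtain ⟨k, rfl⟩ : ∃ k, n = k + 1 := ⟨n - 1, by omega⟩
    rw [lint_iter_succ k x _ hmv]
    have := prob_ustep hm hE x
    calc _ ≤ ∫⁻ z, (ENNReal.ofReal (vD a A z) + ENNReal.ofReal (k * b)) ∂(ustep m E x) + 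
          ENNReal.ofReal (PsiD a x / Lam m E) := by gcongr; exact key0 k _
      _ = (∫⁻ z, ENNReal.ofReal (vD a A z) ∂(ustep m E x) + ENNReal.ofReal (PsiD a x / Lam m E)) +
          ENNReal.ofReal (k * b) := by
        rw [lintegral_add_left hmv, lintegral_const, measure_univ, mul_one]; ring
      _ ≤ ENNReal.ofReal (vD a A x) + ENNReal.ofReal b + ENNReal.ofReal (k * b) := by
        exact add_le_add_left (h x) _
      _ = _ := by
        rw [add_assoc, ← ENNReal.ofReal_add hb.le (by positivity)]
        congr 2; push_cast; ring
  have hn0 : ∀ z : Delta m E, 0 ≤ vD a A z := vD_nonneg a A hA.le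
  have hint : Integrable (vD a A) (ustepIter m E n x) := by
    refine ⟨(meas_vD a A).aestronglyMeasurable, ?_⟩
    rw [hasFiniteIntegral_iff_ofReal (Eventually.of_forall hn0)]
    exact (key0 n x).trans_lt (ENNReal.add_lt_top.2 ⟨ENNReal.ofReal_lt_top, ENNReal.ofReal_lt_top⟩)
  refine ⟨hint, ?_⟩
  have hP := PsiD_nonneg a x
  have hI : 0 ≤ ∫ z, vD a A z ∂(ustepIter m E n x) := integral_nonneg hn0
  rw [← ofReal_integral_eq_lintegral_ofReal hint (Eventually.of_forall hn0), 
    ← ENNReal.ofReal_add hI (by positivity), ← ENNReal.ofReal_add (hn0 x) (by positivity)] at key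
  exact (ENNReal.ofReal_le_ofReal_iff (add_nonneg (hn0 x) (by positivity))).1 key

lemma Psi_ge_tank {m : ℕ} {E : ℝ} (a : ℝ) (x : Delta m E) : tank m E x ^ (-(a - 1/2)) ≤ PsiD a x := 
  le_add_of_nonneg_left (Finset.sum_nonneg fun i _ => Real.rpow_nonneg (x.2.1 i).le _)

lemma Psi_ge_coord {m : ℕ} {E : ℝ} (a : ℝ) (x : Delta m E) (i : Fin m) : 
    x.1 i ^ (-(a - 1/2)) ≤ PsiD a x := by
  have := Finset.single_le_sum (f := fun k => x.1 k ^ (-(a - 1/2))) 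
      (fun k _ => Real.rpow_nonneg (x.2.1 k).le _) (Finset.mem_univ i)
  exact this.trans (le_add_of_nonneg_right (Real.rpow_nonneg (tank_pos x).le _))

lemma v_le_Psi {m : ℕ} {E : ℝ} (hE : 0 < E) (a A : ℝ) (ha : 1/2 < a) (hA : 0 < A) :
    ∃ M : ℝ, 0 < M ∧ ∀ x : Delta m E, vD a A x ≤ M * PsiD a x ^ (a / (a - 1/2)) := by
  set δ := a - 1/2 with hδ
  have hδ0 : 0 < δ := by linarith
  set s := a / δ with hs
  have hs1 : 1 ≤ s := by rw [hs, le_div_iff₀ hδ0]; linarith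
  have hEp : 0 < E ^ (-δ) := Real.rpow_pos_of_pos hE _
  have hEq : 0 < (E ^ (-δ)) ^ (1 - s) := Real.rpow_pos_of_pos hEp _
  refine ⟨m + A * (E ^ (-δ)) ^ (1 - s), by positivity, fun x => ?_⟩
  have hy := tank_pos x
  have hP : E ^ (-δ) ≤ PsiD a x := 
    (Real.rpow_le_rpow_of_nonpos hy (tank_le x) (by linarith)).trans (Psi_ge_tank a x)
  have hP0 : 0 < PsiD a x := hEp.trans_le hP
  have h1 : ∀ i, x.1 i ^ (-a) ≤ PsiD a x ^ s := by
    intro i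
    have : x.1 i ^ (-a) = (x.1 i ^ (-δ)) ^ s := by
      rw [← Real.rpow_mul (x.2.1 i).le]
      congr 1
      rw [hs]; field_simp
    rw [this]
    exact Real.rpow_le_rpow (Real.rpow_nonneg (x.2.1 i).le _) (Psi_ge_coord a x i) (by linarith)
  have h2 : tank m E x ^ (-δ) ≤ (E ^ (-δ)) ^ (1 - s) * PsiD a x ^ s := by
    refine (Psi_ge_tank a x).trans ?_
    have : PsiD a x = PsiD a x ^ (1 - s) * PsiD a x ^ s := by
      rw [← Real.rpow_add hP0]; simp
    calc PsiD a x = PsiD a x ^ (1 - s) * PsiD a x ^ s := this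
      _ ≤ _ := mul_le_mul_of_nonneg_right (Real.rpow_le_rpow_of_nonpos hEp hP (by linarith)) 
        (Real.rpow_nonneg hP0.le _)
  have h3 : ∑ i, x.1 i ^ (-a) ≤ m * PsiD a x ^ s := by
    have := Finset.sum_le_card_nsmul Finset.univ (fun i => x.1 i ^ (-a)) _ fun i _ => h1 i
    simpa using this
  have h4 := mul_le_mul_of_nonneg_left h2 hA.le
  unfold vD
  rw [← hδ]
  linarith

lemma vD_pos {m : ℕ} {E : ℝ} (a A : ℝ) (hA : 0 < A) (x : Delta m E) : 0 < vD a A x := 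
    add_pos_of_nonneg_of_pos (Finset.sum_nonneg fun i _ => Real.rpow_nonneg (x.2.1 i).le _) 
      (mul_pos hA (Real.rpow_pos_of_pos (tank_pos x) _))

lemma rate_pkg {m : ℕ} (hm : 1 ≤ m) {E : ℝ} (hE : 0 < E) (a : ℝ) (ha : 1/2 < a) (ha1 : a < 1) :
    ∃ A κ σ0 : ℝ, 0 < A ∧ 0 < κ ∧ 0 < σ0 ∧ ∀ h : ℕ → Delta m E → ℝ, 
      (∀ q x, Integrable (h q) (ustepIter m E (2 * m) x)) →
      (∀ q x, h (q + 1) x = ∫ z, h q z ∂(ustepIter m E (2 * m) x)) → 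
      (∀ x, 0 ≤ h 0 x ∧ h 0 x ≤ 1) →
      ∀ (q : ℕ) x y, |h q x - h q y| ≤
        (σ0 + q * κ) ^ (-(2 * a)) * (σ0 + (vD a A x + vD a A y) ^ (1 / (2 * a))) ^ (2 * a) := by
  obtain ⟨A, b, hA, hb, h1⟩ := drift_one hm hE a ha ha1
  have hd := drift_iter hm hE a A b hA hb h1 (2 * m) (by omega)
  obtain ⟨M, hM, hv⟩ := v_le_Psi (m := m) hE a A ha hA
  have hL := Lam_pos hm hE
  have hm0 : (0:ℝ) < m := by exact_mod_cast hm
  set δ := a - 1/2 with hδ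
  have hδ0 : 0 < δ := by linarith
  set s := a / δ with hs
  have hs1 : 1 ≤ s := by rw [hs, le_div_iff₀ hδ0]; linarith
  set H : ℝ := 4 * (2 * m) * b * Lam m E with hH
  have hH0 : 0 < H := by positivity
  set e2 : ℝ := min (E / (m + 1)) (H ^ (-(1 / δ))) with he2
  have he20 : 0 < e2 := lt_min (by positivity) (Real.rpow_pos_of_pos hH0 _)
  have heE : e2 * (m + 1) ≤ E := by
    have := min_le_left (E / (m + 1)) (H ^ (-(1 / δ)))
    rwa [← he2, le_div_iff₀ (by positivity)] at this
  have heH : H ≤ e2 ^ (-δ) := by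
    have h2 : e2 ≤ H ^ (-(1 / δ)) := min_le_right _ _
    have h3 := Real.rpow_le_rpow_of_nonpos he20 h2 (show -δ ≤ 0 by linarith)
    refine le_trans (le_of_eq ?_) h3
    rw [← Real.rpow_mul hH0.le]
    have : -(1 / δ) * -δ = 1 := by field_simp
    rw [this, Real.rpow_one]
  obtain ⟨ν, hν0, hν⟩ := minorization hm hE (e2 / 2) (by positivity) (by nlinarith)
  have h2e : 2 * (e2 / 2) = e2 := by ring
  rw [h2e] at hν
  have inst : ∀ x, IsProbabilityMeasure (ustepIter m E (2 * m) x) := prob_iter hm hE _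
  have hMs : 0 < (2 * M) ^ (1 / s) := Real.rpow_pos_of_pos (by positivity) _
  refine Exists.elim (abs_rate (ustepIter m E (2 * m)) (vD a A) (vD_pos a A hA) (2 * a)
    (1 / (2 * Lam m E * (2 * M) ^ (1 / s))) (m * e2 ^ (-a) + A * e2 ^ (-δ) + (2 * m) * b) 
    (by linarith) (by positivity) {x | (∀ i, e2 ≤ x.1 i) ∧ e2 ≤ tank m E x} ν 
    (fun x => (hd x).1) ?_ ?_ (fun x hx => hν x hx.1) hν0 ?_) ?_
  rotate_left 3
  · rintro κ ⟨σ0, hκ, hσ, hh⟩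
    exact ⟨A, κ, σ0, hA, hκ, hσ, hh⟩
  · intro x y hxy
    have hS : H ≤ PsiD a x + PsiD a y := by
      have aux : ∀ x : Delta m E, ¬ ((∀ i, e2 ≤ x.1 i) ∧ e2 ≤ tank m E x) → H ≤ PsiD a x := by
        intro x hx
        rw [not_and_or] at hx
        rcases hx with hx | hx
        · push Not at hx
          obtain ⟨i, hi⟩ := hx
          exact heH.trans ((Real.rpow_le_rpow_of_nonpos (x.2.1 i) hi.le (by linarith)).trans 
            (Psi_ge_coord a x i))
        · push Not at hx
          exact heH.trans ((Real.rpow_le_rpow_of_nonpos (tank_pos x) hx.le (by linarith)).trans 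
            (Psi_ge_tank a x))
      rw [not_and_or] at hxy
      rcases hxy with hx | hy
      · linarith [aux x hx, PsiD_nonneg a y]
      · linarith [aux y hy, PsiD_nonneg a x]
    set S := PsiD a x + PsiD a y with hSd
    have hS0 : 0 < S := hH0.trans_le hS
    have hPx := PsiD_nonneg a x
    have hPy := PsiD_nonneg a y
    have hW : vD a A x + vD a A y ≤ (2 * M) * S ^ s := by
      have i1 : PsiD a x ^ s ≤ S ^ s := Real.rpow_le_rpow hPx (by linarith) (by linarith)
      have i2 : PsiD a y ^ s ≤ S ^ s := Real.rpow_le_rpow hPy (by linarith) (by linarith)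
      have := mul_le_mul_of_nonneg_left i1 hM.le
      have := mul_le_mul_of_nonneg_left i2 hM.le
      linarith [hv x, hv y]
    have hexp : 1 - 1 / (2 * a) = 1 / s := by
      rw [hs, hδ]; field_simp
    have hW0 : 0 ≤ vD a A x + vD a A y := add_nonneg (vD_pos a A hA x).le (vD_pos a A hA y).le
    have hW2 : (vD a A x + vD a A y) ^ (1 / s) ≤ (2 * M) ^ (1 / s) * S := by
      refine (Real.rpow_le_rpow hW0 hW (by positivity)).trans (le_of_eq ?_)
      rw [Real.mul_rpow (by positivity) (by positivity), ← Real.rpow_mul hS0.le]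
      have : s * (1 / s) = 1 := by field_simp
      rw [this, Real.rpow_one]
    rw [hexp]
    have hc : 1 / (2 * Lam m E * (2 * M) ^ (1 / s)) * (vD a A x + vD a A y) ^ (1 / s) ≤ 
        S / (2 * Lam m E) := by
      calc _ ≤ 1 / (2 * Lam m E * (2 * M) ^ (1 / s)) * ((2 * M) ^ (1 / s) * S) := 
            mul_le_mul_of_nonneg_left hW2 (by positivity)
        _ = _ := by field_simp
    have hx := (hd x).2
    have hy := (hd y).2
    push_cast at hx hy
    have h5 : 2 * ((2 * m) * b) ≤ S / (2 * Lam m E) := by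
      rw [le_div_iff₀ (by positivity)]
      rw [hH] at hS
      linarith
    have h6 : PsiD a x / Lam m E + PsiD a y / Lam m E = 2 * (S / (2 * Lam m E)) := by
      rw [hSd]; field_simp
    linarith
  · intro x hx
    have h3 := (hd x).2
    push_cast at h3
    have h4 : 0 ≤ PsiD a x / Lam m E := div_nonneg (PsiD_nonneg a x) hL.le
    have h5 : ∑ i, x.1 i ^ (-a) ≤ m * e2 ^ (-a) := by
      have := Finset.sum_le_card_nsmul Finset.univ (fun i => x.1 i ^ (-a)) (e2 ^ (-a)) 
        fun i _ => Real.rpow_le_rpow_of_nonpos he20 (hx.1 i) (by linarith)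
      simpa using this
    have h6 : tank m E x ^ (-δ) ≤ e2 ^ (-δ) := 
      Real.rpow_le_rpow_of_nonpos he20 hx.2 (by linarith)
    have h7 := mul_le_mul_of_nonneg_left h6 hA.le
    have h8 : vD a A x ≤ m * e2 ^ (-a) + A * e2 ^ (-δ) := add_le_add h5 h7
    linarith
  · have hsum : ∑ _i : Fin m, E / ((m:ℝ) + 1) = E - E / (m + 1) := by
      simp only [Finset.sum_const, Finset.card_univ, Fintype.card_fin, nsmul_eq_mul]
      field_simp
      ring
    have hpos : 0 < E / ((m:ℝ) + 1) := by positivity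
    refine ⟨⟨fun _ => E / (m + 1), fun i => hpos, ?_⟩, fun i => min_le_left _ _, ?_⟩
    · rw [hsum]; linarith
    · simp only [tank]
      rw [hsum, sub_sub_cancel]
      exact min_le_left _ _

lemma iter_real {m : ℕ} (hm : 1 ≤ m) {E : ℝ} (hE : 0 < E) (n k : ℕ) (x : Delta m E) 
    (S : Set (Delta m E)) (hS : MeasurableSet S) :
    Integrable (fun z => (ustepIter m E k z S).toReal) (ustepIter m E n x) ∧
    (ustepIter m E (n + k) x S).toReal 
      = ∫ z, (ustepIter m E k z S).toReal ∂(ustepIter m E n x) := by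
  have hp := prob_iter hm hE
  have hmeas : Measurable fun z => ustepIter m E k z S := 
    (Measure.measurable_coe hS).comp (meas_iter m E k)
  have hfin : ∀ z, ustepIter m E k z S < ⊤ := fun z => measure_lt_top _ _
  refine ⟨?_, ?_⟩
  · refine Integrable.of_bound hmeas.ennreal_toReal.aestronglyMeasurable 1 
      (Eventually.of_forall fun z => ?_)
    rw [Real.norm_of_nonneg ENNReal.toReal_nonneg]
    exact ENNReal.toReal_le_of_le_ofReal zero_le_one (by simpa using prob_le_one)
  · rw [integral_toReal hmeas.aemeasurable (Eventually.of_forall hfin)]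
    congr 1
    have := lint_iter_add n k x (S.indicator 1) (measurable_one.indicator hS)
    simpa [lintegral_indicator_one hS] using this

lemma inv_real {m : ℕ} (hm : 1 ≤ m) {E : ℝ} (hE : 0 < E) (k : ℕ) 
    (S : Set (Delta m E)) (hS : MeasurableSet S) :
    Integrable (fun z => (ustepIter m E k z S).toReal) (piMeasure m E) ∧
    (piMeasure m E S).toReal = ∫ z, (ustepIter m E k z S).toReal ∂(piMeasure m E) := by
  have hp := prob_iter hm hE
  have hpi := prob_pi (m := m) hE
  have hmeas : Measurable fun z => ustepIter m E k z S := 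
    (Measure.measurable_coe hS).comp (meas_iter m E k)
  have hfin : ∀ z, ustepIter m E k z S < ⊤ := fun z => measure_lt_top _ _
  refine ⟨?_, ?_⟩
  · refine Integrable.of_bound hmeas.ennreal_toReal.aestronglyMeasurable 1 
      (Eventually.of_forall fun z => ?_)
    rw [Real.norm_of_nonneg ENNReal.toReal_nonneg]
    exact ENNReal.toReal_le_of_le_ofReal zero_le_one (by simpa using prob_le_one)
  · rw [integral_toReal hmeas.aemeasurable (Eventually.of_forall hfin)]
    congr 1
    have := inv_pi hm hE k (S.indicator 1) (measurable_one.indicator hS)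
    simpa [lintegral_indicator_one hS] using this.symm

lemma add_rpow_bd {u v p : ℝ} (hu : 0 ≤ u) (hv : 0 ≤ v) (hp : 0 ≤ p) :
    (u + v) ^ p ≤ 2 ^ p * (u ^ p + v ^ p) := by
  have h1 : u + v ≤ 2 * max u v := by linarith [le_max_left u v, le_max_right u v]
  have h2 : 0 ≤ max u v := le_max_of_le_left hu
  refine (Real.rpow_le_rpow (by positivity) h1 hp).trans ?_
  rw [Real.mul_rpow (by norm_num) h2]
  refine mul_le_mul_of_nonneg_left ?_ (by positivity)
  rcases max_choice u v with h | h <;> rw [h]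
  · linarith [Real.rpow_nonneg hv p]
  · linarith [Real.rpow_nonneg hu p]

lemma iter_rate {m : ℕ} (hm : 1 ≤ m) {E : ℝ} (hE : 0 < E) (a : ℝ) (ha : 1/2 < a) (ha1 : a < 1) 
    (x : Delta m E) :
    ∃ K : ℝ, 0 ≤ K ∧ ∀ (n : ℕ) (S : Set (Delta m E)), MeasurableSet S → 
      |(ustepIter m E n x S).toReal - (piMeasure m E S).toReal| ≤ K * ((n:ℝ) + 1) ^ (-(2 * a)) := by
  obtain ⟨A, κ, σ0, hA, hκ, hσ, hh⟩ := rate_pkg hm hE a ha ha1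
  have hpi := prob_pi (m := m) hE
  have hp := prob_iter hm hE
  have hvi := int_vD (m := m) hE a A ha.le ha1 hA.le
  have hm0 : (0:ℝ) < m := by exact_mod_cast hm
  set p := 2 * a with hpdef
  have hp0 : 0 < p := by linarith
  set k0 := min σ0 κ with hk0
  have hk00 : 0 < k0 := lt_min hσ hκ
  set I : ℝ := 2 ^ p * (σ0 ^ p + (vD a A x + ∫ y, vD a A y ∂(piMeasure m E))) with hI
  have hI0 : 0 ≤ I := by
    have : 0 ≤ ∫ y, vD a A y ∂(piMeasure m E) := integral_nonneg (vD_nonneg a A hA.le)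
    have := vD_nonneg a A hA.le x
    positivity
  refine ⟨(k0 / (2 * m)) ^ (-p) * I, by positivity, fun n S hS => ?_⟩
  set q := n / (2 * m) with hq
  set r := n % (2 * m) with hr
  have hn : 2 * m * q + r = n := Nat.div_add_mod n (2 * m)
  have hrec : ∀ q' z, (fun q z => (ustepIter m E (2 * m * q + r) z S).toReal) (q' + 1) z 
      = ∫ w, (fun q z => (ustepIter m E (2 * m * q + r) z S).toReal) q' w 
        ∂(ustepIter m E (2 * m) z) := by
    intro q' z
    simp only []
    rw [← (iter_real hm hE (2 * m) (2 * m * q' + r) z S hS).2]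
    congr 3; ring
  have hb := hh (fun q z => (ustepIter m E (2 * m * q + r) z S).toReal) 
    (fun q' z => (iter_real hm hE (2 * m) (2 * m * q' + r) z S hS).1) hrec 
    (fun z => ⟨ENNReal.toReal_nonneg, 
      ENNReal.toReal_le_of_le_ofReal zero_le_one (by simpa using prob_le_one)⟩) q x
  simp only [hn] at hb
  obtain ⟨hi, he⟩ := inv_real hm hE n S hS
  have hqk : 0 < σ0 + q * κ := by positivity
  have hpt : ∀ y, |(ustepIter m E n x S).toReal - (ustepIter m E n y S).toReal| ≤ 
      (σ0 + q * κ) ^ (-p) * (2 ^ p * (σ0 ^ p + (vD a A x + vD a A y))) := by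
    intro y
    refine (hb y).trans (mul_le_mul_of_nonneg_left ?_ (Real.rpow_nonneg hqk.le _))
    have hW0 : 0 ≤ vD a A x + vD a A y := add_nonneg (vD_pos a A hA x).le (vD_pos a A hA y).le
    have := add_rpow_bd (p := p) hσ.le (Real.rpow_nonneg hW0 (1 / p)) hp0.le
    rw [← Real.rpow_mul hW0, one_div_mul_cancel hp0.ne', Real.rpow_one] at this
    exact this
  have hint2 : Integrable (fun y => (σ0 + q * κ) ^ (-p) * (2 ^ p * (σ0 ^ p + (vD a A x + vD a A y)))) 
      (piMeasure m E) := 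
    (((integrable_const _).add ((integrable_const _).add hvi)).const_mul _).const_mul _
  have e1 : (ustepIter m E n x S).toReal - (piMeasure m E S).toReal = 
      ∫ y, ((ustepIter m E n x S).toReal - (ustepIter m E n y S).toReal) ∂(piMeasure m E) := by
    rw [integral_sub (integrable_const _) hi, he]; simp
  have hi3 : Integrable (fun y => vD a A x + vD a A y) (piMeasure m E) := (integrable_const _).add hvi
  have e2 : ∫ y, (σ0 + q * κ) ^ (-p) * (2 ^ p * (σ0 ^ p + (vD a A x + vD a A y))) ∂(piMeasure m E) 
      = (σ0 + q * κ) ^ (-p) * I := by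
    rw [integral_const_mul, integral_const_mul, integral_add (integrable_const _) 
      hi3, integral_add (integrable_const _) hvi]
    simp [hI]
  have h1 : |(ustepIter m E n x S).toReal - (piMeasure m E S).toReal| ≤ (σ0 + q * κ) ^ (-p) * I := by
    rw [e1, ← e2]
    refine (abs_integral_le_integral_abs).trans (integral_mono_of_nonneg 
      (Eventually.of_forall fun y => abs_nonneg _) hint2 (Eventually.of_forall hpt))
  refine h1.trans ?_
  have h2 : (k0 / (2 * m)) * ((n:ℝ) + 1) ≤ σ0 + q * κ := by
    have h3 : n + 1 ≤ 2 * m * (q + 1) := by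
      have : r < 2 * m := Nat.mod_lt _ (by omega)
      nlinarith
    have h4 : (n:ℝ) + 1 ≤ 2 * m * (q + 1) := by exact_mod_cast h3
    calc (k0 / (2 * m)) * ((n:ℝ) + 1) ≤ (k0 / (2 * m)) * (2 * m * (q + 1)) := 
          mul_le_mul_of_nonneg_left h4 (by positivity)
      _ = k0 + q * k0 := by field_simp; ring
      _ ≤ _ := add_le_add (min_le_left _ _) 
        (mul_le_mul_of_nonneg_left (min_le_right _ _) (by positivity))
  have h5 := Real.rpow_le_rpow_of_nonpos (by positivity) h2 (show -p ≤ 0 by linarith)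
  rw [Real.mul_rpow (by positivity) (by positivity)] at h5
  calc _ ≤ ((k0 / (2 * m)) ^ (-p) * ((n:ℝ) + 1) ^ (-p)) * I := mul_le_mul_of_nonneg_right h5 hI0
    _ = _ := by ring

lemma rpow_le_one_add_sq {r p : ℝ} (hr : 0 < r) (hp0 : 0 ≤ p) (hp : p ≤ 2) : r ^ p ≤ 1 + r ^ 2 := by
  rcases le_total r 1 with h | h
  · have := Real.rpow_le_one hr.le h hp0
    nlinarith [sq_nonneg r]
  · have := Real.rpow_le_rpow_of_exponent_le h hp
    rw [Real.rpow_two] at this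
    linarith

noncomputable def pw (l : ℝ) (n : ℕ) : ℝ := Real.exp (-l) * l ^ n / n.factorial

lemma pw_nonneg {l : ℝ} (hl : 0 ≤ l) (n : ℕ) : 0 ≤ pw l n := by unfold pw; positivity

lemma pw_hasSum (l : ℝ) : HasSum (pw l) 1 := by
  have h := (NormedSpace.expSeries_div_hasSum_exp (𝔸 := ℝ) l).mul_left (Real.exp (-l))
  rw [← Real.exp_eq_exp_ℝ, ← Real.exp_add] at h
  simp only [neg_add_cancel, Real.exp_zero] at h
  refine h.congr_fun ?_
  intro n
  unfold pw
  ring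

lemma pw_bd {l p : ℝ} (hl : 0 < l) (hp0 : 0 ≤ p) (hp : p ≤ 2) (n : ℕ) :
    pw l n * ((n:ℝ) + 1) ^ (-p) ≤ l ^ (-p) * (pw l n + 2 * pw l (n + 2)) := by
  have hn : (0:ℝ) < (n:ℝ) + 1 := by positivity
  have h1 := rpow_le_one_add_sq (r := l / (n + 1)) (by positivity) hp0 hp
  have h2 : ((n:ℝ) + 1) ^ (-p) = l ^ (-p) * (l / (n + 1)) ^ p := by
    rw [Real.div_rpow hl.le hn.le, Real.rpow_neg hn.le, Real.rpow_neg hl.le]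
    have := Real.rpow_pos_of_pos hl p
    have := Real.rpow_pos_of_pos hn p
    field_simp
  have h3 : pw l n * (l / (n + 1)) ^ 2 ≤ 2 * pw l (n + 2) := by
    have e : pw l (n + 2) = pw l n * (l ^ 2 / ((n + 1) * (n + 2))) := by
      unfold pw
      rw [Nat.factorial_succ, Nat.factorial_succ]
      push_cast
      have : (n.factorial : ℝ) ≠ 0 := by positivity
      field_simp
      ring
    rw [e]
    have : (l / (n + 1)) ^ 2 ≤ 2 * (l ^ 2 / (((n:ℝ) + 1) * (n + 2))) := by
      rw [div_pow, ← mul_div_assoc, div_le_div_iff₀ (by positivity) (by positivity)]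
      have : ((n:ℝ) + 1) * (n + 2) ≤ 2 * (n + 1) ^ 2 := by nlinarith [(Nat.cast_nonneg n : (0:ℝ) ≤ n)]
      have := mul_le_mul_of_nonneg_left this (sq_nonneg l)
      linarith
    have := mul_le_mul_of_nonneg_left this (pw_nonneg hl.le n)
    linarith
  rw [h2]
  have h4 := mul_le_mul_of_nonneg_left h1 (pw_nonneg hl.le n)
  calc pw l n * (l ^ (-p) * (l / (n + 1)) ^ p) = l ^ (-p) * (pw l n * (l / (n + 1)) ^ p) := by ring
    _ ≤ l ^ (-p) * (pw l n + 2 * pw l (n + 2)) := by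
      refine mul_le_mul_of_nonneg_left ?_ (Real.rpow_nonneg hl.le _)
      linarith

lemma Pt_rate {m : ℕ} (hm : 1 ≤ m) {E : ℝ} (hE : 0 < E) (x : Delta m E) (p K : ℝ) (hp0 : 0 ≤ p) 
    (hp : p ≤ 2) (hK : 0 ≤ K) (h : ∀ (n : ℕ) (S : Set (Delta m E)), MeasurableSet S → 
      |(ustepIter m E n x S).toReal - (piMeasure m E S).toReal| ≤ K * ((n:ℝ) + 1) ^ (-p)) 
    (t : ℝ) (ht : 0 < t) :
    tvDist (Pt m E t x) (piMeasure m E) ≤ 3 * K * (Lam m E * t) ^ (-p) := by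
  have hL := Lam_pos hm hE
  have hpr := prob_iter hm hE
  set l := Lam m E * t with hl
  have hl0 : 0 < l := by positivity
  have : Nonempty {A : Set (Delta m E) // MeasurableSet A} := ⟨⟨∅, MeasurableSet.empty⟩⟩
  unfold tvDist
  refine ciSup_le fun ⟨S, hS⟩ => ?_
  have hw := pw_hasSum l
  set f : ℕ → ℝ := fun n => (ustepIter m E n x S).toReal with hf
  have hf0 : ∀ n, 0 ≤ f n := fun n => ENNReal.toReal_nonneg
  have hf1 : ∀ n, f n ≤ 1 := fun n => 
    ENNReal.toReal_le_of_le_ofReal zero_le_one (by simpa using prob_le_one)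
  have e1 : (Pt m E t x S).toReal = ∑' n, pw l n * f n := by
    unfold Pt
    rw [Measure.sum_apply _ hS, ENNReal.tsum_toReal_eq]
    · refine tsum_congr fun n => ?_
      rw [Measure.smul_apply, smul_eq_mul, ENNReal.toReal_mul, neg_mul, ← hl, ENNReal.toReal_ofReal]
      · rfl
      · exact pw_nonneg hl0.le n
    · intro n
      rw [Measure.smul_apply, smul_eq_mul]
      exact ENNReal.mul_ne_top ENNReal.ofReal_ne_top (measure_ne_top _ _)
  have hsf : Summable fun n => pw l n * f n := 
    Summable.of_nonneg_of_le (fun n => mul_nonneg (pw_nonneg hl0.le n) (hf0 n)) 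
      (fun n => mul_le_of_le_one_right (pw_nonneg hl0.le n) (hf1 n)) hw.summable
  set P := (piMeasure m E S).toReal with hP
  have e2 : HasSum (fun n => pw l n * (f n - P)) ((Pt m E t x S).toReal - P) := by
    rw [e1]
    have := hsf.hasSum.sub (hw.mul_right P)
    simpa [mul_sub] using this
  have hw2 : Summable fun n => pw l (n + 2) := (summable_nat_add_iff 2).2 hw.summable
  have hg : HasSum (fun n => K * (l ^ (-p) * (pw l n + 2 * pw l (n + 2)))) 
      (K * (l ^ (-p) * (1 + 2 * ∑' n, pw l (n + 2)))) := 
    ((hw.add (hw2.hasSum.mul_left 2)).mul_left _).mul_left _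
  have hw3 : ∑' n, pw l (n + 2) ≤ 1 := by
    have := hw.summable.sum_add_tsum_nat_add 2
    rw [hw.tsum_eq] at this
    have h5 := Finset.sum_nonneg (s := Finset.range 2) fun n _ => pw_nonneg hl0.le n
    linarith
  have hb : ∀ n, ‖pw l n * (f n - P)‖ ≤ K * (l ^ (-p) * (pw l n + 2 * pw l (n + 2))) := by
    intro n
    rw [norm_mul, Real.norm_of_nonneg (pw_nonneg hl0.le n), Real.norm_eq_abs]
    have h1 := mul_le_mul_of_nonneg_left (h n S hS) (pw_nonneg hl0.le n)
    have h2 := mul_le_mul_of_nonneg_left (pw_bd hl0 hp0 hp n) hK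
    refine h1.trans ?_
    linarith
  have := tsum_of_norm_bounded hg hb
  rw [e2.tsum_eq, Real.norm_eq_abs] at this
  refine this.trans ?_
  have h6 : 0 ≤ K * l ^ (-p) := mul_nonneg hK (Real.rpow_nonneg hl0.le _)
  nlinarith

/-- Theorem 2, speed of convergence to equilibrium.
For every `x ∈ Δ` and every `γ > 0`, `t^{2-γ} ‖P^t(x,·) - π‖_TV → 0` as `t → ∞`. -/
theorem polynomial_convergence_to_equilibrium (m : ℕ) (hm : 1 ≤ m) (E : ℝ) (hE : 0 < E)
    (x : Delta m E) (γ : ℝ) (hγ : 0 < γ) :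
    Tendsto (fun t : ℝ => t ^ (2 - γ) * tvDist (Pt m E t x) (piMeasure m E))
      atTop (nhds 0) := by
  set g := min γ 1 with hg
  have hg0 : 0 < g := lt_min hγ one_pos
  have hg1 : g ≤ 1 := min_le_right _ _
  have hgγ : g ≤ γ := min_le_left _ _
  have hL := Lam_pos hm hE
  obtain ⟨K, hK, h⟩ := iter_rate hm hE (1 - g / 4) (by linarith) (by linarith) x
  have hr := Pt_rate hm hE x _ K (by linarith) (by linarith) hK h
  set p := 2 * (1 - g / 4) with hp
  have hlim : Tendsto (fun t : ℝ => 3 * K * Lam m E ^ (-p) * t ^ (-(p - (2 - γ)))) atTop (nhds 0) := by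
    have := (tendsto_rpow_neg_atTop (y := p - (2 - γ)) (by linarith)).const_mul 
      (3 * K * Lam m E ^ (-p))
    simpa using this
  refine tendsto_of_tendsto_of_tendsto_of_le_of_le' tendsto_const_nhds hlim ?_ ?_
  · filter_upwards [eventually_gt_atTop 0] with t ht
    exact mul_nonneg (Real.rpow_nonneg ht.le _) (Real.iSup_nonneg fun _ => abs_nonneg _)
  · filter_upwards [eventually_gt_atTop 0] with t ht
    have h1 := mul_le_mul_of_nonneg_left (hr t ht) (Real.rpow_nonneg ht.le (2 - γ))
    refine h1.trans (le_of_eq ?_)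
    rw [Real.mul_rpow hL.le ht.le, show -(p - (2 - γ)) = (2 - γ) + -p by ring, Real.rpow_add ht]
    ring
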